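/- arXiv:1410.8764 — 2 statements merged into one kernel-verified Lean document; each statement's English description precedes it below -/
import Mathlib

section
/- Let R be a noetherian integral domain such that the localization R_m satisfies condition (††) for every maximal ideal m of R. Let P be a finitely generated abelian group and let A = R[x_1,…,x_n] be a polynomial R-algebra, P-graded by declaring each x_i homogeneous of degree λ_i ∈ P and R of degree 0 (i.e., A = Sym_R(V) for V = ⊕_{i=1}^n R·x_i a direct sum of rank-one homogeneous free P-graded R-modules). Then every finitely generated P-graded A-module that is projective as an A-module is extended from R, i.e., isomorphic as a P-graded A-module to F ⊗_R A for some P-graded R-module F that is finitely generated projective over R. -/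
open scoped TensorProduct

universe u

/-! ### Properties of commutative (additive) monoids -/

/-- `Q` is cancellative: `a + x = a + y → x = y`. -/
def IsCancellativeAddMonoid (Q : Type*) [AddCommMonoid Q] : Prop :=
  ∀ a x y : Q, a + x = a + y → x = y

/-- `Q` is torsion-free: `n • x = n • y` for some `n > 0` implies `x = y`. -/
def IsTorsionFreeAddMonoid (Q : Type*) [AddCommMonoid Q] : Prop :=
  ∀ n : ℕ, 0 < n → ∀ x y : Q, n • x = n • y → x = y

/-- `Q` is seminormal: an element `x = a - b` of the Grothendieck group with
`2x, 3x ∈ Q` lies in `Q` (stated elementwise via representatives). -/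
def IsSeminormalAddMonoid (Q : Type*) [AddCommMonoid Q] : Prop :=
  ∀ a b : Q, (∃ y : Q, a + a = b + b + y) → (∃ z : Q, a + a + a = b + b + b + z) →
    ∃ w : Q, a = b + w

/-- `Q` is normal: an element `x = a - b` of the Grothendieck group with
`n • x ∈ Q` for some `n > 0` lies in `Q` (stated elementwise via representatives). -/
def IsNormalAddMonoid (Q : Type*) [AddCommMonoid Q] : Prop :=
  ∀ a b : Q, (∃ n : ℕ, 0 < n ∧ ∃ y : Q, n • a = n • b + y) → ∃ w : Q, a = b + w

/-- `Q` has no nontrivial unit: `x + y = 0 → x = 0`. -/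
def HasNoNontrivialAddUnits (Q : Type*) [AddCommMonoid Q] : Prop :=
  ∀ x y : Q, x + y = 0 → x = 0

/-! ### Freeness/extension conditions on rings -/

/-- Every (not necessarily finitely generated) projective `R`-module is free. -/
def AllProjectiveFree (R : Type u) [CommRing R] : Prop :=
  ∀ (M : Type u) [AddCommGroup M] [Module R M], Module.Projective R M → Module.Free R M

/-- Every finitely generated projective `B`-module is free. -/
def AllFGProjectiveFree (B : Type u) [CommRing B] : Prop :=
  ∀ (M : Type u) [AddCommGroup M] [Module B M],
    Module.Finite B M → Module.Projective B M → Module.Free B M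

/-- Every finitely generated projective `B`-module is extended from `R`, i.e. of the form
`B ⊗_R F` for a finitely generated projective `R`-module `F`. -/
def AllFGProjectiveExtended (R B : Type u) [CommRing R] [CommRing B] [Algebra R B] : Prop :=
  ∀ (M : Type u) [AddCommGroup M] [Module B M],
    Module.Finite B M → Module.Projective B M →
    ∃ (F : Type u) (_ : AddCommGroup F) (_ : Module R F),
      Module.Finite R F ∧ Module.Projective R F ∧ Nonempty (M ≃ₗ[B] B ⊗[R] F)

/-- Condition (†): every projective `R`-module is free and every finitely generated
projective module over the group algebra `R[Q]` of a torsion-free abelian group `Q`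
is extended from `R`. -/
def CondDagger (R : Type u) [CommRing R] : Prop :=
  AllProjectiveFree R ∧
  ∀ (Q : Type u) [AddCommGroup Q], IsTorsionFreeAddMonoid Q →
    AllFGProjectiveExtended R (AddMonoidAlgebra R Q)

/-- Condition (††): every projective `R`-module is free and every finitely generated
projective module over `R[Q × ℤ^n]` is extended from `R`, whenever `Q` is torsion-free,
seminormal, cancellative and has no nontrivial unit. -/
def CondDaggerDagger (R : Type u) [CommRing R] : Prop :=
  AllProjectiveFree R ∧
  ∀ (n : ℕ) (Q : Type u) [AddCommMonoid Q],
    IsCancellativeAddMonoid Q → IsTorsionFreeAddMonoid Q → IsSeminormalAddMonoid Q →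
    HasNoNontrivialAddUnits Q →
    AllFGProjectiveExtended R (AddMonoidAlgebra R (Q × (Fin n → ℤ)))

/-! ### Gradings -/

/-- A map `f` is degree-preserving for the gradings `ℳ`, `𝒩`. -/
def MapsGraded {P M N : Type*} {R : Type*} [Semiring R] [AddCommMonoid M] [AddCommMonoid N]
    [Module R M] [Module R N] (f : M → N)
    (ℳ : P → Submodule R M) (𝒩 : P → Submodule R N) : Prop :=
  ∀ c : P, ∀ m ∈ ℳ c, f m ∈ 𝒩 c

/-- `𝒜` is a `P`-grading of the `R`-algebra `A`:
`A = ⊕_{a ∈ P} A_a`, `A_a · A_b ⊆ A_{a+b}`, `1 ∈ A_0`. -/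
structure IsGradedRing {R A P : Type*} [CommRing R] [Ring A] [Algebra R A]
    [AddCommGroup P] [DecidableEq P] (𝒜 : P → Submodule R A) : Prop where
  is_internal : DirectSum.IsInternal 𝒜
  one_mem : (1 : A) ∈ 𝒜 0
  mul_mem : ∀ {a b : P} {x y : A}, x ∈ 𝒜 a → y ∈ 𝒜 b → x * y ∈ 𝒜 (a + b)

/-- `ℳ` is a `P`-grading of the `A`-module `M`, compatible with the grading `𝒜` of `A`:
`M = ⊕_{a ∈ P} M_a` and `A_a • M_b ⊆ M_{a+b}`. -/
structure IsGradedModule {R A P M : Type*} [CommRing R] [Ring A] [Algebra R A]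
    [AddCommGroup P] [DecidableEq P] [AddCommGroup M] [Module R M] [Module A M]
    [IsScalarTower R A M] (𝒜 : P → Submodule R A) (ℳ : P → Submodule R M) : Prop where
  is_internal : DirectSum.IsInternal ℳ
  smul_mem : ∀ {a b : P} {x : A} {m : M}, x ∈ 𝒜 a → m ∈ ℳ b → x • m ∈ ℳ (a + b)

/-- The natural `P`-grading on `B ⊗[R] F`: `(B ⊗ F)_c = ⊕_{a+b=c} B_a ⊗ F_b`. -/
noncomputable def tensorGrading {R B F P : Type*} [CommRing R] [CommRing B] [Algebra R B]
    [AddCommGroup P] [AddCommGroup F] [Module R F]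
    (ℬ : P → Submodule R B) (ℱ : P → Submodule R F) : P → Submodule R (B ⊗[R] F) :=
  fun c => Submodule.span R
    {z | ∃ a b : P, a + b = c ∧ ∃ x ∈ ℬ a, ∃ f ∈ ℱ b, z = x ⊗ₜ[R] f}

/-- A `P`-graded `A`-module `(M, ℳ)` is (equivariantly) extended from `R`, i.e. trivial:
it is isomorphic, as a `P`-graded `A`-module, to `A ⊗_R F` for some `P`-graded `R`-module
`F` which is finitely generated and projective over `R`. -/
def IsGradedExtendedFrom (R : Type u) {A P : Type u} [CommRing R] [CommRing A]
    [Algebra R A] [AddCommGroup P] [DecidableEq P] (𝒜 : P → Submodule R A)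
    (M : Type u) [AddCommGroup M] [Module R M] [Module A M] [IsScalarTower R A M]
    (ℳ : P → Submodule R M) : Prop :=
  ∃ (F : Type u) (_ : AddCommGroup F) (_ : Module R F) (ℱ : P → Submodule R F),
    DirectSum.IsInternal ℱ ∧ Module.Finite R F ∧ Module.Projective R F ∧
    ∃ e : M ≃ₗ[A] A ⊗[R] F,
      MapsGraded (⇑e) ℳ (tensorGrading 𝒜 ℱ) ∧ MapsGraded (⇑e.symm) (tensorGrading 𝒜 ℱ) ℳ

/-! ### Monoid algebras, cones and faces -/

/-- The grading of a monoid algebra `R[Λ]` induced by a degree function `deg : Λ → P`: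
the piece of degree `p` is spanned by the monomials `e_s` with `deg s = p`. -/
noncomputable def monAlgGrading (R : Type*) [CommRing R] {Λ P : Type*} [AddCommMonoid Λ]
    (deg : Λ → P) : P → Submodule R (AddMonoidAlgebra R Λ) :=
  fun p => Submodule.span R {x | ∃ s : Λ, deg s = p ∧ x = AddMonoidAlgebra.single s 1}

/-- The lattice points `σ ∩ L` of the rational polyhedral cone
`σ = ⋂ᵢ (l i)⁻¹(ℚ≥0)` in `L ⊗ ℚ`. -/
def coneLatticePoints {L : Type*} [AddCommGroup L] {q : ℕ} (l : Fin q → L →+ ℚ) :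
    AddSubmonoid L where
  carrier := {m | ∀ i, 0 ≤ l i m}
  zero_mem' := fun i => by simp
  add_mem' := by
    intro a b ha hb i
    rw [map_add]
    exact add_nonneg (ha i) (hb i)

/-- The lattice points `τ ∩ L` of the face `τ = σ ∩ l'⁻¹(0)` of the cone `σ`. -/
def faceLatticePoints {L : Type*} [AddCommGroup L] {q : ℕ} (l : Fin q → L →+ ℚ)
    (l' : L →+ ℚ) : AddSubmonoid L where
  carrier := {m | (∀ i, 0 ≤ l i m) ∧ l' m = 0}
  zero_mem' := ⟨fun i => by simp, by simp⟩
  add_mem' := by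
    intro a b ha hb
    refine ⟨fun i => ?_, ?_⟩
    · rw [map_add]; exact add_nonneg (ha.1 i) (hb.1 i)
    · rw [map_add, ha.2, hb.2, add_zero]

/-- The submonoid of elements of a submonoid `S ⊆ L` killed by `ψ : L →+ P`
(the "invariant" part of `S`). -/
def kerSubmonoidIn {L P : Type*} [AddCommMonoid L] [AddCommMonoid P]
    (S : AddSubmonoid L) (ψ : L →+ P) : AddSubmonoid L where
  carrier := {m | m ∈ S ∧ ψ m = 0}
  zero_mem' := ⟨S.zero_mem, map_zero ψ⟩
  add_mem' := by
    intro a b ha hb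
    exact ⟨S.add_mem ha.1 hb.1, by rw [map_add, ha.2, hb.2, add_zero]⟩

/-- The kernel submonoid `{q ∈ Q | u q = 0}` of a monoid homomorphism `u : Q →+ P`. -/
def kerSubmonoid {Q P : Type*} [AddCommMonoid Q] [AddCommMonoid P] (u : Q →+ P) :
    AddSubmonoid Q where
  carrier := {q | u q = 0}
  zero_mem' := map_zero u
  add_mem' := by
    intro a b ha hb
    simp only [Set.mem_setOf_eq] at *
    rw [map_add, ha, hb, add_zero]

/-- `S` spans `L ⊗ ℚ`: a positive multiple of every lattice element is a difference of
elements of `S` (this expresses that the cone is "strongly convex", i.e. spans `L_ℚ`). -/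
def SpansLattice {L : Type*} [AddCommGroup L] (S : AddSubmonoid L) : Prop :=
  ∀ m : L, ∃ n : ℕ, 0 < n ∧ ∃ x ∈ S, ∃ y ∈ S, (n : ℤ) • m = x - y

section

/-- A matrix whose `(i, j)` entry is homogeneous of degree `d i - d' j`. -/
def IsGradedMatrix {P R A ι κ : Type*} [AddCommGroup P] [CommRing R] [CommRing A] [Algebra R A]
    (𝒜 : P → Submodule R A) (d : ι → P) (d' : κ → P) (M : Matrix ι κ A) : Prop :=
  ∀ i j, M i j ∈ 𝒜 (d i - d' j)

namespace IsGradedMatrix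

variable {P R A ι κ τ : Type*} [AddCommGroup P] [CommRing R] [CommRing A] [Algebra R A]
  {𝒜 : P → Submodule R A} {d : ι → P} {d' : κ → P} {d'' : τ → P}

theorem add {M N : Matrix ι κ A} (hM : IsGradedMatrix 𝒜 d d' M) (hN : IsGradedMatrix 𝒜 d d' N) :
    IsGradedMatrix 𝒜 d d' (M + N) := fun i j => add_mem (hM i j) (hN i j)

theorem sub {M N : Matrix ι κ A} (hM : IsGradedMatrix 𝒜 d d' M) (hN : IsGradedMatrix 𝒜 d d' N) :
    IsGradedMatrix 𝒜 d d' (M - N) := fun i j => sub_mem (hM i j) (hN i j)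

theorem transpose {M : Matrix ι κ A} (hM : IsGradedMatrix 𝒜 d d' M) :
    IsGradedMatrix 𝒜 (fun j => - d' j) (fun i => - d i) M.transpose := fun i j => by
  have := hM j i
  rwa [show - d' i - - d j = d j - d' i by abel]

variable [SetLike.GradedMonoid 𝒜]

theorem one [DecidableEq ι] (d : ι → P) : IsGradedMatrix 𝒜 d d 1 := fun i j => by
  by_cases h : i = j
  · subst h
    simpa using SetLike.GradedOne.one_mem
  · simp [h]

theorem mul [Fintype κ] {M : Matrix ι κ A} {N : Matrix κ τ A} (hM : IsGradedMatrix 𝒜 d d' M)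
    (hN : IsGradedMatrix 𝒜 d' d'' N) : IsGradedMatrix 𝒜 d d'' (M * N) := fun i j => by
  rw [Matrix.mul_apply]
  refine sum_mem fun k _ => ?_
  have := SetLike.GradedMul.mul_mem (hM i k) (hN k j)
  rwa [show d i - d' k + (d' k - d'' j) = d i - d'' j by abel] at this

theorem smul {M : Matrix ι κ A} (hM : IsGradedMatrix 𝒜 d d' M) {c : A} (hc : c ∈ 𝒜 0) :
    IsGradedMatrix 𝒜 d d' (c • M) := fun i j => by
  have := SetLike.GradedMul.mul_mem hc (hM i j)
  rwa [zero_add] at this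

theorem det_mem [Fintype ι] [DecidableEq ι] {d' : ι → P} {M : Matrix ι ι A}
    (hM : IsGradedMatrix 𝒜 d d' M) : M.det ∈ 𝒜 (∑ i, d i - ∑ i, d' i) := by
  rw [Matrix.det_apply]
  refine sum_mem fun s _ => ?_
  have h : ∏ i, M (s i) i ∈ 𝒜 (∑ i, d i - ∑ i, d' i) := by
    have := SetLike.prod_mem_graded 𝒜 (fun i => d (s i) - d' i) (fun i => M (s i) i)
      (F := Finset.univ) (fun i _ => hM (s i) i)
    rwa [Finset.sum_sub_distrib, Equiv.sum_comp s d] at this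
  rcases Int.units_eq_one_or (Equiv.Perm.sign s) with h1 | h1 <;> rw [h1]
  · simpa using h
  · simpa using h

theorem adjugate [Fintype ι] [DecidableEq ι] {M : Matrix ι ι A} (hM : IsGradedMatrix 𝒜 d d M) :
    IsGradedMatrix 𝒜 d d M.adjugate := fun i j => by
  rw [Matrix.adjugate_apply]
  have : IsGradedMatrix 𝒜 (Function.update d j (d i)) d (M.updateRow j (Pi.single i 1)) := by
    intro k l
    by_cases hk : k = j
    · subst hk
      rw [Matrix.updateRow_self, Function.update_self]
      by_cases h : i = l
      · subst h
        simpa using SetLike.GradedOne.one_mem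
      · rw [Pi.single_apply, if_neg (Ne.symm h)]
        exact zero_mem _
    · rw [Matrix.updateRow_ne hk, Function.update_of_ne hk]
      exact hM k l
  have h := this.det_mem
  rw [Finset.sum_update_of_mem (Finset.mem_univ j), ← Finset.add_sum_erase _ d (Finset.mem_univ j),
    ← Finset.sdiff_singleton_eq_erase] at h
  rwa [add_sub_add_right_eq_sub] at h

end IsGradedMatrix

theorem exists_conj_of_locally_conj {C S : Type*} [CommRing C] [Ring S] [Algebra C S]
    (φ : C → S →+* S) (hφ : ∀ a c, φ a (algebraMap C S c) = algebraMap C S c)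
    (hdiv : ∀ a b c s, ∃ t, φ (a + c * b) s - φ a s = c • t)
    (hreg : ∀ c : C, c ≠ 0 → ∀ s : S, c • s = 0 → s = 0)
    (e e₀ : S) (h₀ : ∀ a, φ a e₀ = e₀) (hφ0 : φ 0 e = e₀) (hφ1 : φ 1 e = e)
    (H : ∀ m : Ideal C, m.IsMaximal → ∃ f, f ∉ m ∧ f ≠ 0 ∧ ∃ u v : S,
      u * v = algebraMap C S f ∧ v * u = algebraMap C S f ∧ e * u = u * e₀) :
    ∃ u v : S, u * v = 1 ∧ v * u = 1 ∧ e * u = u * e₀ := by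
  have cancel : ∀ c : C, c ≠ 0 → ∀ s t : S, c • s = c • t → s = t := fun c hc s t h =>
    sub_eq_zero.1 (hreg c hc _ (by rw [smul_sub, h, sub_self]))
  let Q (c : C) : Prop := ∀ a b, ∃ u v : S, u * v = 1 ∧ v * u = 1 ∧
    φ (a + c * b) e * u = u * φ a e
  let J : Ideal C :=
    { carrier := {c | Q c}
      zero_mem' := fun a b => ⟨1, 1, by simp, by simp, by simp⟩
      add_mem' := by
        intro c c' hc hc' a b
        obtain ⟨u, v, h1, h2, h3⟩ := hc a b
        obtain ⟨u', v', h1', h2', h3'⟩ := hc' (a + c * b) b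
        refine ⟨u' * u, v * v', ?_, ?_, ?_⟩
        · rw [mul_assoc, ← mul_assoc u, h1, one_mul, h1']
        · rw [mul_assoc, ← mul_assoc v', h2', one_mul, h2]
        · rw [add_mul c c' b, ← add_assoc, ← mul_assoc, h3', mul_assoc, h3, mul_assoc]
      smul_mem' := by
        intro r c hc a b
        obtain ⟨u, v, h⟩ := hc a (r * b)
        refine ⟨u, v, ?_⟩
        rwa [smul_eq_mul, show r * c * b = c * (r * b) by ring] }
  have hJ : J = ⊤ := by
    by_contra hne
    obtain ⟨m, hm, hle⟩ := Ideal.exists_le_maximal J hne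
    obtain ⟨f, hfm, hf0, u, v, huv, hvu, heu⟩ := H m hm
    refine hfm (hle ?_)
    intro a b
    have hsc : ∀ x : S, algebraMap C S f * x = f • x := fun x => (Algebra.smul_def f x).symm
    have hsc' : ∀ x : S, x * algebraMap C S f = f • x := fun x => by
      rw [← Algebra.commutes, hsc]
    obtain ⟨s, hs⟩ := hdiv a b f u
    obtain ⟨t, ht⟩ := hdiv a b f v
    have huva : ∀ a, φ a u * φ a v = algebraMap C S f := fun a => by rw [← map_mul, huv, hφ]
    have hvua : ∀ a, φ a v * φ a u = algebraMap C S f := fun a => by rw [← map_mul, hvu, hφ]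
    have heua : ∀ a, φ a e * φ a u = φ a u * e₀ := fun a => by rw [← map_mul, heu, map_mul, h₀]
    have h1 : φ (a + f * b) u * φ a v = f • (1 + s * φ a v) := by
      rw [sub_eq_iff_eq_add.1 hs, add_mul, huva, smul_add, smul_mul_assoc, Algebra.algebraMap_eq_smul_one,
        add_comm]
    have h2 : φ a u * φ (a + f * b) v = f • (1 + φ a u * t) := by
      rw [sub_eq_iff_eq_add.1 ht, mul_add, huva, smul_add, mul_smul_comm,
        Algebra.algebraMap_eq_smul_one, add_comm]
    refine ⟨1 + s * φ a v, 1 + φ a u * t, ?_, ?_, ?_⟩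
    · refine cancel f hf0 _ _ (cancel f hf0 _ _ ?_)
      rw [← mul_smul_comm, ← smul_mul_assoc, ← h1, ← h2, mul_assoc, ← mul_assoc (φ a v), hvua,
        hsc, mul_smul_comm, huva, Algebra.algebraMap_eq_smul_one]
    · refine cancel f hf0 _ _ (cancel f hf0 _ _ ?_)
      rw [← mul_smul_comm, ← smul_mul_assoc, ← h1, ← h2, mul_assoc, ← mul_assoc (φ (a + f * b) v),
        hvua, hsc, mul_smul_comm, huva, Algebra.algebraMap_eq_smul_one]
    · refine cancel f hf0 _ _ (cancel f hf0 _ _ ?_)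
      have h3 : f • (φ (a + f * b) u * e₀ * φ a v) = f • (φ (a + f * b) u * φ a v * φ a e) := by
        have : φ a v * φ a e * φ a u * φ a v = f • (e₀ * φ a v) := by
          rw [mul_assoc (φ a v), heua, ← mul_assoc, hvua, hsc, smul_mul_assoc]
        rw [mul_assoc (φ a v * φ a e), huva, hsc'] at this
        rw [mul_assoc, ← mul_smul_comm, ← this, mul_smul_comm, mul_assoc]
      rw [← mul_smul_comm, ← h1, ← mul_assoc, heua, h3, h1, smul_mul_assoc]
  obtain ⟨u, v, h⟩ := (hJ ▸ Submodule.mem_top : (1 : C) ∈ J) 0 1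
  refine ⟨u, v, ?_⟩
  rwa [one_mul, zero_add, hφ1, hφ0] at h

end

section

open LaurentPolynomial in
/-- The grading of `D[T;T⁻¹]` in which `T` has degree `l`. -/
noncomputable def laurentGrading {P R D : Type*} [AddCommGroup P] [CommRing R] [CommRing D] [Algebra R D]
    (𝒟 : P → Submodule R D) (l : P) (p : P) : Submodule R D[T;T⁻¹] where
  carrier := {f | ∀ k : ℤ, f.coeff k ∈ 𝒟 (p - k • l)}
  zero_mem' := fun k => by simp
  add_mem' := fun hf hg k => by simpa using add_mem (hf k) (hg k)
  smul_mem' := fun r f hf k => by simpa using Submodule.smul_mem _ r (hf k)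

open LaurentPolynomial in
/-- The Laurent polynomials that are polynomials in `T`. -/
noncomputable def laurentNonneg (D : Type*) [CommRing D] : Subalgebra D D[T;T⁻¹] :=
  (Polynomial.toLaurentAlg (R := D)).range

namespace LaurentPolynomial

variable {P R D : Type*} [AddCommGroup P] [CommRing R] [CommRing D] [Algebra R D]
    {𝒟 : P → Submodule R D} {l : P}

theorem coeff_T_mul (n : ℤ) (f : D[T;T⁻¹]) (k : ℤ) : (T n * f).coeff k = f.coeff (k - n) := by
  rw [T, AddMonoidAlgebra.coeff_single_mul_apply, one_mul, neg_add_eq_sub]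

theorem coeff_C_mul (a : D) (f : D[T;T⁻¹]) (k : ℤ) : (C a * f).coeff k = a * f.coeff k := by
  rw [← smul_eq_C_mul, AddMonoidAlgebra.coeff_smul_apply, smul_eq_mul]

theorem coeff_toLaurent_natCast (f : Polynomial D) (k : ℕ) :
    (Polynomial.toLaurent f).coeff (k : ℤ) = f.coeff k := by
  rw [coeff_toLaurent]
  exact Finsupp.mapDomain_apply Nat.cast_injective _ _

theorem coeff_toLaurent_of_neg (f : Polynomial D) {k : ℤ} (hk : k < 0) :
    (Polynomial.toLaurent f).coeff k = 0 := by
  rw [coeff_toLaurent]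
  refine Finsupp.mapDomain_of_notMem_range _ _ ?_
  rintro ⟨n, hn⟩
  simp at hn
  omega

theorem mem_laurentNonneg {f : D[T;T⁻¹]} :
    f ∈ laurentNonneg D ↔ ∀ k < 0, f.coeff k = 0 := by
  constructor
  · rintro ⟨p, rfl⟩ k hk
    exact coeff_toLaurent_of_neg p hk
  · intro h
    rw [← AddMonoidAlgebra.sum_coeff_single f]
    refine sum_mem fun k hk => ?_
    have hk0 : 0 ≤ k := by
      by_contra hlt
      exact Finsupp.mem_support_iff.1 hk (h k (not_le.1 hlt))
    obtain ⟨n, rfl⟩ := Int.eq_ofNat_of_zero_le hk0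
    refine ⟨Polynomial.C (f.coeff n) * Polynomial.X ^ n, ?_⟩
    change Polynomial.toLaurent _ = _
    rw [Polynomial.toLaurent_C_mul_X_pow]
    exact (single_eq_C_mul_T _ _).symm

theorem T_mem_laurentNonneg {n : ℤ} (hn : 0 ≤ n) : (T n : D[T;T⁻¹]) ∈ laurentNonneg D :=
  mem_laurentNonneg.2 fun k hk => by rw [T_apply, if_neg (by omega)]

theorem C_mem_laurentNonneg (a : D) : (C a : D[T;T⁻¹]) ∈ laurentNonneg D :=
  mem_laurentNonneg.2 fun k hk => by rw [C_apply, if_neg (by omega)]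

theorem exists_T_mul_mem_laurentNonneg {ι : Type*} [Finite ι] (f : ι → D[T;T⁻¹]) :
    ∃ N : ℕ, ∀ i, T (N : ℤ) * f i ∈ laurentNonneg D := by
  classical
  cases nonempty_fintype ι
  choose n p hp using fun i => exists_T_pow (f i)
  refine ⟨∑ i, n i, fun i => ?_⟩
  rw [← Finset.add_sum_erase _ _ (Finset.mem_univ i), add_comm, Nat.cast_add, T_add, mul_assoc,
    T_mul (n i : ℤ), ← hp]
  exact mul_mem (T_mem_laurentNonneg (Int.natCast_nonneg _)) ⟨p i, rfl⟩

theorem mem_laurentGrading {p : P} {f : D[T;T⁻¹]} :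
    f ∈ laurentGrading 𝒟 l p ↔ ∀ k : ℤ, f.coeff k ∈ 𝒟 (p - k • l) := Iff.rfl

theorem T_mul_mem_laurentGrading {p : P} {f : D[T;T⁻¹]} (hf : f ∈ laurentGrading 𝒟 l p) (n : ℤ) :
    T n * f ∈ laurentGrading 𝒟 l (p + n • l) := fun k => by
  rw [coeff_T_mul, show p + n • l - k • l = p - (k - n) • l by rw [sub_smul]; abel]
  exact hf _

theorem C_mem_laurentGrading {p : P} {a : D} (ha : a ∈ 𝒟 p) : C a ∈ laurentGrading 𝒟 l p :=
  fun k => by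
    rw [C_apply]
    split_ifs with h
    · rw [h]
      simpa using ha
    · exact zero_mem _

variable [SetLike.GradedMonoid 𝒟]

theorem C_mul_mem_laurentGrading {p q : P} {a : D} {f : D[T;T⁻¹]} (ha : a ∈ 𝒟 q)
    (hf : f ∈ laurentGrading 𝒟 l p) : C a * f ∈ laurentGrading 𝒟 l (q + p) := fun k => by
  rw [coeff_C_mul, show q + p - k • l = q + (p - k • l) by abel]
  exact SetLike.GradedMul.mul_mem ha (hf k)

instance : SetLike.GradedMonoid (laurentGrading 𝒟 l) where
  one_mem := fun k => by
    rw [← map_one C, C_apply]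
    split_ifs with h
    · rw [h, zero_smul, sub_zero]
      exact SetLike.GradedOne.one_mem
    · exact zero_mem _
  mul_mem := fun p q f g hf hg => by
    rw [← AddMonoidAlgebra.sum_coeff_single f, Finsupp.sum, Finset.sum_mul]
    refine sum_mem fun k _ => ?_
    rw [single_eq_C_mul_T, mul_assoc]
    have := C_mul_mem_laurentGrading (hf k) (T_mul_mem_laurentGrading hg k)
    rwa [show p - k • l + (q + k • l) = p + q by abel] at this

end LaurentPolynomial

theorem Matrix.mul_eq_smul_one_symm {n : Type*} [Fintype n] [DecidableEq n] {A : Type*} [CommRing A]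
    [IsDomain A] {X Y : Matrix n n A} {c : A} (hc : c ≠ 0) (h : X * Y = c • 1) : Y * X = c • 1 := by
  have h1 : (Y * X - c • 1) * Y = 0 := by
    rw [sub_mul, mul_assoc, h, Matrix.mul_smul, mul_one, Matrix.smul_mul, one_mul, sub_self]
  have hY : Y.det ≠ 0 := by
    intro h0
    have := congrArg Matrix.det h
    rw [Matrix.det_mul, h0, mul_zero, Matrix.det_smul, Matrix.det_one, mul_one] at this
    exact pow_ne_zero _ hc this.symm
  have h2 : Y.det • (Y * X - c • 1) = 0 := by
    rw [← mul_one (Y * X - c • 1), ← Matrix.mul_smul, ← Matrix.mul_adjugate, ← mul_assoc, h1,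
      zero_mul]
  exact sub_eq_zero.1 ((smul_eq_zero.1 h2).resolve_left hY)

/-- `V` and `W` are homogeneous matrices exhibiting, after inverting `g`, the image of the
idempotent matrix `E` as a free graded module with basis in the degrees `δ`. -/
structure IsGradedFactorization {P R A ι σ : Type*} [AddCommGroup P] [CommRing R] [CommRing A]
    [Algebra R A] [Fintype ι] [Fintype σ] [DecidableEq σ] (𝒜 : P → Submodule R A)
    (d : ι → P) (E : Matrix ι ι A) (δ : σ → P) (V : Matrix ι σ A) (W : Matrix σ ι A) (g : A) :
    Prop where
  graded_left : IsGradedMatrix 𝒜 d δ V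
  graded_right : IsGradedMatrix 𝒜 δ d W
  mul_eq : V * W = g • E
  mul_eq_one : W * V = g • 1

theorem IsGradedFactorization.transpose {P R A ι σ : Type*} [AddCommGroup P] [CommRing R]
    [CommRing A] [Algebra R A] [Fintype ι] [Fintype σ] [DecidableEq σ] {𝒜 : P → Submodule R A}
    {d : ι → P} {E : Matrix ι ι A} {δ : σ → P} {V : Matrix ι σ A} {W : Matrix σ ι A} {g : A}
    (h : IsGradedFactorization 𝒜 d E δ V W g) :
    IsGradedFactorization 𝒜 (fun i => - d i) E.transpose (fun i => - δ i) W.transpose V.transpose g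
    where
  graded_left := h.graded_right.transpose
  graded_right := h.graded_left.transpose
  mul_eq := by rw [← Matrix.transpose_mul, h.mul_eq, Matrix.transpose_smul]
  mul_eq_one := by
    rw [← Matrix.transpose_mul, h.mul_eq_one, Matrix.transpose_smul, Matrix.transpose_one]

/-- The map on Laurent polynomials induced by a ring homomorphism on the coefficients. -/
noncomputable def LaurentPolynomial.mapCoeff {D κ : Type*} [CommRing D] [CommRing κ] (ρ : D →+* κ) :
    AddMonoidAlgebra D ℤ →+* AddMonoidAlgebra κ ℤ :=
  AddMonoidAlgebra.mapRingHom ℤ ρ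

namespace LaurentPolynomial

variable {D κ : Type*} [CommRing D] [CommRing κ] (ρ : D →+* κ)

theorem coeff_mapCoeff (f : D[T;T⁻¹]) (k : ℤ) : (mapCoeff ρ f).coeff k = ρ (f.coeff k) :=
  AddMonoidAlgebra.coeff_mapRingHom _ _ _

theorem mapCoeff_C (a : D) : mapCoeff ρ (C a) = C (ρ a) := by
  ext k
  rw [coeff_mapCoeff, C_apply, C_apply]
  split_ifs <;> simp

theorem mapCoeff_mem_laurentNonneg {f : D[T;T⁻¹]} (hf : f ∈ laurentNonneg D) :
    mapCoeff ρ f ∈ laurentNonneg κ :=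
  mem_laurentNonneg.2 fun k hk => by rw [coeff_mapCoeff, mem_laurentNonneg.1 hf k hk, map_zero]

end LaurentPolynomial

end

section

open DirectSum in
theorem exists_isMaximal_graded_lift {P R D : Type*} [AddCommGroup P] [DecidableEq P] [CommRing R]
    [CommRing D] [Algebra R D] (𝒟 : P → Submodule R D) [GradedAlgebra 𝒟] (m : Ideal (𝒟 0))
    (hm : m.IsMaximal) :
    ∃ n : Ideal D, n.IsMaximal ∧ (∀ c : 𝒟 0, (c : D) ∈ n ↔ c ∈ m) ∧
      ∀ p, ∀ a ∈ 𝒟 p, a ∉ n → ∃ b ∈ 𝒟 (-p), a * b ∉ n := by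
  have hz : ∀ {p : P} {a : D}, a ∈ 𝒟 p → ∀ b : D,
      (decompose 𝒟 (a * b) 0 : D) = a * decompose 𝒟 b (-p) := fun {p a} ha b => by
    have := coe_decompose_mul_add_of_left_mem 𝒟 (b := b) (j := -p) ha
    rwa [add_neg_cancel] at this
  let J : Ideal D :=
    { carrier := {a | ∀ b, decompose 𝒟 (a * b) 0 ∈ m}
      zero_mem' := fun b => by simp
      add_mem' := fun {a a'} ha ha' b => by
        rw [add_mul, decompose_add, DirectSum.add_apply]
        exact add_mem (ha b) (ha' b)
      smul_mem' := fun c a ha b => by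
        rw [smul_eq_mul, mul_comm c, mul_assoc]
        exact ha _ }
  have hJm : ∀ c ∈ m, (c : D) ∈ J := fun c hc b => by
    have : decompose 𝒟 ((c : D) * b) 0 = c * decompose 𝒟 b 0 := by
      ext
      rw [hz c.2, neg_zero]
      rfl
    rw [this]
    exact Ideal.mul_mem_right _ _ hc
  have hJ : J ≠ ⊤ := by
    intro h
    have h1 : (1 : D) ∈ J := h ▸ Submodule.mem_top
    have h2 := h1 1
    rw [mul_one] at h2
    have h3 : decompose 𝒟 (1 : D) 0 = 1 := by
      ext
      exact decompose_of_mem_same 𝒟 SetLike.GradedOne.one_mem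
    rw [h3] at h2
    exact hm.ne_top ((Ideal.eq_top_iff_one _).2 h2)
  obtain ⟨n, hn, hle⟩ := Ideal.exists_le_maximal J hJ
  have hmem : ∀ c : 𝒟 0, (c : D) ∈ n ↔ c ∈ m := fun c => by
    refine ⟨fun hc => ?_, fun hc => hle (hJm c hc)⟩
    by_contra hcm
    obtain ⟨y, z, hz, hyz⟩ := hm.exists_inv hcm
    refine hn.ne_top ((Ideal.eq_top_iff_one _).2 ?_)
    have : (1 : D) = (y : D) * c + z := congrArg Subtype.val hyz.symm
    rw [this]
    exact add_mem (Ideal.mul_mem_left _ _ hc) (hle (hJm z hz))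
  refine ⟨n, hn, hmem, fun p a ha han => ?_⟩
  have : a ∉ J := fun h => han (hle h)
  obtain ⟨b, hb⟩ := not_forall.1 this
  refine ⟨decompose 𝒟 b (-p), SetLike.coe_mem _, ?_⟩
  rw [← hz ha]
  exact fun h => hb ((hmem _).1 h)

end

section

open LaurentPolynomial Matrix
open scoped Polynomial

/-- The vectors of polynomials in the span over `κ[X]` of the columns of a matrix over
`κ[T;T⁻¹]`. -/
noncomputable def polynomialColSpan {κ ι σ : Type*} [CommRing κ] [Fintype σ]
    (M : Matrix ι σ κ[T;T⁻¹]) : Submodule κ[X] (ι → κ[X]) where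
  carrier := {v | ∃ c : σ → κ[X], (fun i => Polynomial.toLaurent (v i)) = M *ᵥ fun j => Polynomial.toLaurent (c j)}
  zero_mem' := ⟨0, by
    rw [show (fun j => Polynomial.toLaurent ((0 : σ → κ[X]) j)) = 0 by ext1; simp,
      Matrix.mulVec_zero]
    ext1
    simp⟩
  add_mem' := by
    rintro v w ⟨c, hc⟩ ⟨c', hc'⟩
    refine ⟨c + c', ?_⟩
    have h1 : (fun j => Polynomial.toLaurent ((c + c') j)) =
        (fun j => Polynomial.toLaurent (c j)) + fun j => Polynomial.toLaurent (c' j) := by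
      ext1; simp
    rw [h1, Matrix.mulVec_add, ← hc, ← hc']
    ext1
    simp
  smul_mem' := by
    rintro p v ⟨c, hc⟩
    refine ⟨p • c, ?_⟩
    have h1 : (fun j => Polynomial.toLaurent ((p • c) j)) = Polynomial.toLaurent p • fun j => Polynomial.toLaurent (c j) := by
      ext1; simp
    rw [h1, Matrix.mulVec_smul, ← hc]
    ext1
    simp

theorem Matrix.updateCol_one_mul {σ τ A : Type*} [CommRing A] [Fintype σ] [DecidableEq σ]
    (j : σ) (u : σ → A) (N : Matrix σ τ A) (i : σ) (k : τ) :
    ((1 : Matrix σ σ A).updateCol j u * N) i k = (if i = j then 0 else N i k) + u i * N j k := by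
  rw [Matrix.mul_apply, ← Finset.add_sum_erase _ _ (Finset.mem_univ j), add_comm,
    Matrix.updateCol_self]
  congr 1
  have : ∀ x ∈ Finset.univ.erase j, (1 : Matrix σ σ A).updateCol j u i x * N x k =
      if x = i then N i k else 0 := fun x hx => by
    rw [Matrix.updateCol_ne (Finset.ne_of_mem_erase hx), Matrix.one_apply]
    by_cases h : i = x
    · simp [h]
    · simp [h, Ne.symm h]
  rw [Finset.sum_congr rfl this, Finset.sum_ite_eq']
  by_cases h : i = j <;> simp [h]

section

variable {P R D κ ι σ : Type*} [AddCommGroup P] [CommRing R] [CommRing D] [Algebra R D]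
  [IsDomain D] [Field κ] {𝒟 : P → Submodule R D} [SetLike.GradedMonoid 𝒟] {l : P}
  [Fintype ι] [Fintype σ] [DecidableEq σ]

theorem IsGradedFactorization.exists_lt {ρ : D →+* κ}
    (hρ : ∀ p, ∀ a ∈ 𝒟 p, ρ a ≠ 0 → ∃ b ∈ 𝒟 (-p), ρ (a * b) ≠ 0) {d : ι → P}
    {E : Matrix ι ι D[T;T⁻¹]} (hE : ∀ i j, mapCoeff ρ (E i j) ∈ laurentNonneg κ)
    {δ : σ → P} {V : Matrix ι σ D[T;T⁻¹]} {W : Matrix σ ι D[T;T⁻¹]} {g : D} (hg : g ∈ 𝒟 0)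
    (hg0 : ρ g ≠ 0) (h : IsGradedFactorization (laurentGrading 𝒟 l) d E δ V W (C g))
    (hV : ∀ i j, mapCoeff ρ (V i j) ∈ laurentNonneg κ)
    (hW : ∃ j i, mapCoeff ρ (W j i) ∉ laurentNonneg κ) :
    ∃ (δ' : σ → P) (V' : Matrix ι σ D[T;T⁻¹]) (W' : Matrix σ ι D[T;T⁻¹]) (g' : D),
      g' ∈ 𝒟 0 ∧ ρ g' ≠ 0 ∧ IsGradedFactorization (laurentGrading 𝒟 l) d E δ' V' W' (C g') ∧
      (∀ i j, mapCoeff ρ (V' i j) ∈ laurentNonneg κ) ∧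
      polynomialColSpan (V.map (mapCoeff ρ)) < polynomialColSpan (V'.map (mapCoeff ρ)) := by
  classical
  obtain ⟨j₁, i₀, hji⟩ := hW
  rw [mem_laurentNonneg] at hji
  push Not at hji
  obtain ⟨k₁, hk₁, hk₁'⟩ := hji
  have hbdd : ∃ b : ℤ, ∀ z : ℤ, (∃ j, ρ ((W j i₀).coeff z) ≠ 0) → b ≤ z := by
    obtain ⟨N, hN⟩ := exists_T_mul_mem_laurentNonneg fun j => W j i₀
    refine ⟨-N, fun z hz => ?_⟩
    obtain ⟨j, hj⟩ := hz
    by_contra hlt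
    refine hj ?_
    have := mem_laurentNonneg.1 (hN j) (z + N) (by omega)
    rw [coeff_T_mul, add_sub_cancel_right] at this
    rw [this, map_zero]
  obtain ⟨lb, ⟨j₀, hj₀⟩, hmin⟩ := Int.exists_least_of_bdd hbdd
    ⟨k₁, j₁, by rwa [← coeff_mapCoeff]⟩
  have hlb : lb < 0 := (hmin k₁ ⟨j₁, by rwa [← coeff_mapCoeff]⟩).trans_lt hk₁
  set a : σ → D := fun j => (W j i₀).coeff lb with ha
  have ha_mem : ∀ j, a j ∈ 𝒟 (δ j - d i₀ - lb • l) := fun j => h.graded_right j i₀ lb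
  obtain ⟨b, hb, hb0⟩ := hρ _ _ (ha_mem j₀) hj₀
  set c : D := a j₀ * b with hc
  have hc_mem : c ∈ 𝒟 0 := by
    have := SetLike.GradedMul.mul_mem (ha_mem j₀) hb
    rwa [add_neg_cancel] at this
  have hcne : c ≠ 0 := fun h0 => hb0 (by rw [h0, map_zero])
  set u : σ → D[T;T⁻¹] := fun j => C (a j) * T (-1) with hu
  set w : σ → D[T;T⁻¹] := fun j => if j = j₀ then C b * T 1 else - C (b * a j) with hw
  set B : Matrix σ σ D[T;T⁻¹] := (1 : Matrix σ σ D[T;T⁻¹]).updateCol j₀ u with hB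
  set B' : Matrix σ σ D[T;T⁻¹] := ((C c) • (1 : Matrix σ σ D[T;T⁻¹])).updateCol j₀ w with hB'
  have hBB' : B * B' = C c • 1 := by
    ext1 i k
    rw [hB, Matrix.updateCol_one_mul]
    by_cases hk : k = j₀
    · subst hk
      rw [hB', updateCol_self, updateCol_self]
      by_cases hi : i = k
      · subst hi
        simp only [hw, hu, if_true, Matrix.smul_apply, Matrix.one_apply_eq, zero_add, hc, map_mul,
          smul_eq_mul, mul_one]
        rw [mul_mul_mul_comm, ← T_add]
        simp
      · simp only [hw, hu, if_true, if_neg hi, Matrix.smul_apply, Matrix.one_apply_ne hi, map_mul,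
          smul_zero]
        rw [mul_mul_mul_comm, ← T_add, mul_comm (C b)]
        simp
    · rw [hB', updateCol_ne hk, updateCol_ne hk]
      by_cases hi : i = j₀
      · subst hi
        simp [Matrix.one_apply_ne (Ne.symm hk)]
      · simp [hi, Matrix.one_apply_ne (Ne.symm hk)]
  have hCc : (C c : D[T;T⁻¹]) ≠ 0 := fun h0 => by
    have := congrArg (fun f : D[T;T⁻¹] => f.coeff 0) h0
    simp only [C_apply, if_true] at this
    exact hcne (by simpa using this)
  have hB'B : B' * B = C c • 1 := Matrix.mul_eq_smul_one_symm hCc hBB'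
  set δ' : σ → P := fun j => if j = j₀ then d i₀ + (lb + 1) • l else δ j with hδ'
  have hBgr : IsGradedMatrix (laurentGrading 𝒟 l) δ δ' B := by
    intro i k
    by_cases hk : k = j₀
    · subst hk
      rw [hB, updateCol_self, hu, hδ']
      simp only [if_true]
      rw [mul_comm]
      have := T_mul_mem_laurentGrading (C_mem_laurentGrading (l := l) (ha_mem i)) (-1)
      rwa [show δ i - d i₀ - lb • l + (-1 : ℤ) • l = δ i - (d i₀ + (lb + 1) • l) by
        rw [add_smul, neg_smul]; abel] at this
    · rw [hB, updateCol_ne hk, hδ']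
      simp only [if_neg hk]
      exact IsGradedMatrix.one δ i k
  have hB'gr : IsGradedMatrix (laurentGrading 𝒟 l) δ' δ B' := by
    intro i k
    by_cases hk : k = j₀
    · subst hk
      rw [hB', updateCol_self, hw, hδ']
      by_cases hi : i = k
      · subst hi
        simp only [if_true]
        rw [mul_comm]
        have := T_mul_mem_laurentGrading (C_mem_laurentGrading (l := l) hb) 1
        rwa [show -(δ i - d i₀ - lb • l) + (1 : ℤ) • l = d i₀ + (lb + 1) • l - δ i by
          rw [add_smul]; abel] at this
      · simp only [if_neg hi]
        have := C_mem_laurentGrading (l := l) (SetLike.GradedMul.mul_mem hb (ha_mem i))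
        rw [show -(δ k - d i₀ - lb • l) + (δ i - d i₀ - lb • l) = δ i - δ k by abel] at this
        exact neg_mem this
    · rw [hB', updateCol_ne hk, hδ']
      by_cases hi : i = j₀
      · subst hi
        rw [Matrix.smul_apply, Matrix.one_apply_ne (Ne.symm hk), smul_zero]
        exact zero_mem _
      · simp only [if_neg hi]
        exact (IsGradedMatrix.one δ).smul (C_mem_laurentGrading hc_mem) i k
  set m := mapCoeff ρ with hm
  have hWV : W.map m * V.map m = C (ρ g) • 1 := by
    rw [← Matrix.map_mul, h.mul_eq_one]
    ext1 i j
    by_cases hij : i = j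
    · subst hij
      simp [hm, mapCoeff_C]
    · simp [Matrix.one_apply_ne hij]
  have hVW : ∀ i j, (V.map m * W.map m) i j = C (ρ g) * m (E i j) := fun i j => by
    rw [← Matrix.map_mul, h.mul_eq, Matrix.map_apply, Matrix.smul_apply, smul_eq_mul, map_mul, hm,
      mapCoeff_C]
  have hn : ∀ j, T (-lb - 1) * m (W j i₀) - m (u j) ∈ laurentNonneg κ := fun j => by
    rw [mem_laurentNonneg]
    intro k hk
    have h1 : (m (u j)).coeff k = if k = -1 then ρ (a j) else 0 := by
      rw [hu, hm, coeff_mapCoeff, coeff_C_mul, T_apply]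
      by_cases hk1 : k = -1
      · simp [hk1]
      · simp [hk1, Ne.symm hk1]
    rw [AddMonoidAlgebra.coeff_sub, Finsupp.sub_apply, h1, coeff_T_mul, hm, coeff_mapCoeff]
    split_ifs with hk1
    · rw [show k - (-lb - 1) = lb by omega, sub_self]
    · rw [sub_zero]
      by_contra hne
      have := hmin _ ⟨j, hne⟩
      omega
  have hVBne : ∀ i k, k ≠ j₀ → (V * B) i k = V i k := fun i k hk => by
    rw [Matrix.mul_apply, hB]
    simp only [updateCol_ne hk]
    rw [← Matrix.mul_apply, Matrix.mul_one]
  have hV' : ∀ i k, m ((V * B) i k) ∈ laurentNonneg κ := fun i k => by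
    by_cases hk : k = j₀
    · subst hk
      have h1 : m ((V * B) i k) = T (-lb - 1) * (C (ρ g) * m (E i i₀)) -
          ∑ j, m (V i j) * (T (-lb - 1) * m (W j i₀) - m (u j)) := by
        rw [← hVW, Matrix.mul_apply, Matrix.mul_apply, map_sum, Finset.mul_sum,
          ← Finset.sum_sub_distrib]
        refine Finset.sum_congr rfl fun j _ => ?_
        rw [hB, updateCol_self, map_mul, Matrix.map_apply, Matrix.map_apply]
        ring
      rw [h1]
      exact sub_mem (mul_mem (T_mem_laurentNonneg (by omega))
        (mul_mem (C_mem_laurentNonneg _) (hE _ _))) (sum_mem fun j _ => mul_mem (hV _ _) (hn j))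
    · rw [hVBne i k hk]
      exact hV i k
  refine ⟨δ', V * B, B' * W, g * c, ?_, ?_, ⟨h.graded_left.mul hBgr, hB'gr.mul h.graded_right,
    ?_, ?_⟩, hV', ?_⟩
  · have := SetLike.GradedMul.mul_mem hg hc_mem
    rwa [add_zero] at this
  · rw [map_mul]
    exact mul_ne_zero hg0 hb0
  · rw [Matrix.mul_assoc, ← Matrix.mul_assoc B, hBB', Matrix.smul_mul, Matrix.one_mul, Matrix.mul_smul, h.mul_eq,
      smul_smul, ← map_mul, mul_comm c]
  · rw [Matrix.mul_assoc, ← Matrix.mul_assoc W, h.mul_eq_one, Matrix.smul_mul, Matrix.one_mul, Matrix.mul_smul, hB'B,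
      smul_smul, ← map_mul]
  rw [SetLike.lt_iff_le_and_exists]
  constructor
  · rintro v ⟨x, hx⟩
    have hB'n : ∀ i k, m (B' i k) ∈ laurentNonneg κ := fun i k => by
      refine mapCoeff_mem_laurentNonneg ρ ?_
      by_cases hk : k = j₀
      · subst hk
        rw [hB', updateCol_self, hw]
        by_cases hi : i = k
        · simp only [if_pos hi]
          exact mul_mem (C_mem_laurentNonneg _) (T_mem_laurentNonneg zero_le_one)
        · simp only [if_neg hi]
          exact neg_mem (C_mem_laurentNonneg _)
      · rw [hB', updateCol_ne hk, Matrix.smul_apply, Matrix.one_apply, smul_eq_mul]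
        refine mul_mem (C_mem_laurentNonneg _) ?_
        split_ifs
        · exact one_mem _
        · exact zero_mem _
    have hy : ∀ i, (C (ρ c)⁻¹ • (B'.map m *ᵥ fun j => Polynomial.toLaurent (x j))) i ∈
        laurentNonneg κ := fun i => by
      rw [Pi.smul_apply, smul_eq_mul, Matrix.mulVec, dotProduct]
      exact mul_mem (C_mem_laurentNonneg _) (sum_mem fun j _ => mul_mem (hB'n _ _) ⟨x j, rfl⟩)
    choose y hy' using hy
    refine ⟨y, ?_⟩
    have hy'' : (fun j => Polynomial.toLaurent (y j)) =
        C (ρ c)⁻¹ • (B'.map m *ᵥ fun j => Polynomial.toLaurent (x j)) := funext hy'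
    rw [hy'', Matrix.mulVec_smul, Matrix.mulVec_mulVec, ← Matrix.map_mul, Matrix.mul_assoc, hBB',
      Matrix.mul_smul, Matrix.mul_one, hx]
    have : (C c • V).map m = C (ρ c) • V.map m := by
      ext1 i j
      simp [hm, mapCoeff_C]
    rw [this, Matrix.smul_mulVec, smul_smul, ← map_mul, inv_mul_cancel₀ hb0, map_one, one_smul]
  · choose y hy using fun i => hV' i j₀
    have hy' : (fun i => Polynomial.toLaurent (y i)) = (V.map m * B.map m) *ᵥ Pi.single j₀ 1 := by
      ext1 i
      rw [Matrix.mulVec_single_one, ← Matrix.map_mul]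
      exact hy i
    refine ⟨y, ⟨Pi.single j₀ 1, ?_⟩, ?_⟩
    · rw [hy', Matrix.map_mul]
      congr 1
      ext1 j
      by_cases hj : j = j₀
      · subst hj
        simp
      · simp [hj]
    · rintro ⟨x, hx⟩
      rw [hy'] at hx
      have h1 := congrArg (fun z => (W.map m *ᵥ z) j₀) hx
      simp only [Matrix.mulVec_mulVec] at h1
      rw [← Matrix.mul_assoc, hWV, Matrix.smul_mul, Matrix.one_mul, Matrix.mulVec_single_one, Matrix.smul_mulVec,
        Matrix.one_mulVec] at h1
      have h2 : (C (ρ g) * m (u j₀)) = C (ρ g) * Polynomial.toLaurent (x j₀) := by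
        rw [← smul_eq_mul, ← smul_eq_mul]
        convert h1 using 1
        · simp [hB]
        · rfl
      have h3 := congrArg (fun f : κ[T;T⁻¹] => f.coeff (-1)) h2
      simp only [coeff_C_mul, coeff_toLaurent_of_neg _ (show (-1 : ℤ) < 0 by norm_num)] at h3
      rw [hu, hm, coeff_mapCoeff, coeff_C_mul, T_apply, if_pos rfl, mul_one, mul_zero] at h3
      exact mul_ne_zero hg0 hj₀ h3

theorem IsGradedFactorization.exists_nonneg {ρ : D →+* κ}
    (hρ : ∀ p, ∀ a ∈ 𝒟 p, ρ a ≠ 0 → ∃ b ∈ 𝒟 (-p), ρ (a * b) ≠ 0) {d : ι → P}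
    {E : Matrix ι ι D[T;T⁻¹]} (hE : ∀ i j, mapCoeff ρ (E i j) ∈ laurentNonneg κ)
    {δ : σ → P} {V : Matrix ι σ D[T;T⁻¹]} {W : Matrix σ ι D[T;T⁻¹]} {g : D} (hg : g ∈ 𝒟 0)
    (hg0 : ρ g ≠ 0) (h : IsGradedFactorization (laurentGrading 𝒟 l) d E δ V W (C g)) :
    ∃ (δ' : σ → P) (V' : Matrix ι σ D[T;T⁻¹]) (W' : Matrix σ ι D[T;T⁻¹]) (g' : D),
      g' ∈ 𝒟 0 ∧ ρ g' ≠ 0 ∧ IsGradedFactorization (laurentGrading 𝒟 l) d E δ' V' W' (C g') ∧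
      (∀ i j, mapCoeff ρ (V' i j) ∈ laurentNonneg κ) ∧
      ∀ j i, mapCoeff ρ (W' j i) ∈ laurentNonneg κ := by
  obtain ⟨N, hN⟩ := exists_T_mul_mem_laurentNonneg fun x : ι × σ => V x.1 x.2
  suffices H : ∀ (S : Submodule κ[X] (ι → κ[X])) (δ : σ → P) (V : Matrix ι σ D[T;T⁻¹])
      (W : Matrix σ ι D[T;T⁻¹]) (g : D), g ∈ 𝒟 0 → ρ g ≠ 0 →
      IsGradedFactorization (laurentGrading 𝒟 l) d E δ V W (C g) →
      (∀ i j, mapCoeff ρ (V i j) ∈ laurentNonneg κ) →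
      polynomialColSpan (V.map (mapCoeff ρ)) = S →
      ∃ (δ' : σ → P) (V' : Matrix ι σ D[T;T⁻¹]) (W' : Matrix σ ι D[T;T⁻¹]) (g' : D),
        g' ∈ 𝒟 0 ∧ ρ g' ≠ 0 ∧ IsGradedFactorization (laurentGrading 𝒟 l) d E δ' V' W' (C g') ∧
        (∀ i j, mapCoeff ρ (V' i j) ∈ laurentNonneg κ) ∧
        ∀ j i, mapCoeff ρ (W' j i) ∈ laurentNonneg κ by
    refine H _ (fun j => δ j - (N : ℤ) • l) ((T (N : ℤ) : D[T;T⁻¹]) • V)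
      ((T (-(N : ℤ)) : D[T;T⁻¹]) • W) g hg hg0 ⟨?_, ?_, ?_, ?_⟩ ?_ rfl
    · intro i j
      have := T_mul_mem_laurentGrading (h.graded_left i j) N
      rwa [show d i - δ j + (N : ℤ) • l = d i - (δ j - (N : ℤ) • l) by abel] at this
    · intro j i
      have := T_mul_mem_laurentGrading (h.graded_right j i) (-N)
      rwa [show δ j - d i + (-(N : ℤ)) • l = δ j - (N : ℤ) • l - d i by
        rw [neg_smul]; abel] at this
    · rw [Matrix.smul_mul, Matrix.mul_smul, smul_smul, ← T_add, h.mul_eq]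
      simp
    · rw [Matrix.smul_mul, Matrix.mul_smul, smul_smul, ← T_add, h.mul_eq_one]
      simp
    · exact fun i j => mapCoeff_mem_laurentNonneg ρ (hN (i, j))
  intro S
  induction S using WellFoundedGT.induction with
  | ind S ih =>
    intro δ V W g hg hg0 h hV hS
    by_cases hW : ∃ j i, mapCoeff ρ (W j i) ∉ laurentNonneg κ
    · obtain ⟨δ', V', W', g', hg', hg0', h', hV', hlt⟩ := h.exists_lt hρ hE hg hg0 hV hW
      exact ih _ (hS ▸ hlt) δ' V' W' g' hg' hg0' h' hV' rfl
    · push Not at hW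
      exact ⟨δ, V, W, g, hg, hg0, h, hV, hW⟩
end

end

section

open LaurentPolynomial Matrix
open scoped Polynomial

namespace LaurentPolynomial

variable {P R D : Type*} [AddCommGroup P] [CommRing R] [CommRing D] [Algebra R D]
    {𝒟 : P → Submodule R D} {l : P}

/-- The part of a Laurent polynomial supported on the exponents satisfying `p`. -/
noncomputable def filterCoeff (p : ℤ → Prop) [DecidablePred p] (f : D[T;T⁻¹]) : D[T;T⁻¹] :=
  AddMonoidAlgebra.ofCoeff (f.coeff.filter p)

theorem coeff_filterCoeff (p : ℤ → Prop) [DecidablePred p] (f : D[T;T⁻¹]) (k : ℤ) :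
    (filterCoeff p f).coeff k = if p k then f.coeff k else 0 :=
  Finsupp.filter_apply _ _ _

theorem filterCoeff_mem_laurentGrading (p : ℤ → Prop) [DecidablePred p] {f : D[T;T⁻¹]} {q : P}
    (hf : f ∈ laurentGrading 𝒟 l q) : filterCoeff p f ∈ laurentGrading 𝒟 l q := fun k => by
  rw [coeff_filterCoeff]
  split_ifs
  · exact hf k
  · exact zero_mem _

theorem coeff_sum_apply {ι : Type*} (s : Finset ι) (f : ι → D[T;T⁻¹]) (k : ℤ) :
    (∑ i ∈ s, f i).coeff k = ∑ i ∈ s, (f i).coeff k := by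
  rw [AddMonoidAlgebra.coeff_sum, Finsupp.finsetSum_apply]

end LaurentPolynomial

section

variable {P R D κ ι σ : Type*} [AddCommGroup P] [CommRing R] [CommRing D] [Algebra R D]
  [Field κ] {𝒟 : P → Submodule R D} [SetLike.GradedMonoid 𝒟] {l : P}
  [Fintype ι] [Fintype σ] [DecidableEq σ]

theorem IsGradedFactorization.exists_mul_nonneg {ρ : D →+* κ} {d : ι → P}
    {E : Matrix ι ι D[T;T⁻¹]} (hE : ∀ i j, E i j ∈ laurentNonneg D)
    {δ : σ → P} {V : Matrix ι σ D[T;T⁻¹]} {W : Matrix σ ι D[T;T⁻¹]} {g : D}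
    (hg0 : ρ g ≠ 0) (h : IsGradedFactorization (laurentGrading 𝒟 l) d E δ V W (C g))
    (hV : ∀ i j, mapCoeff ρ (V i j) ∈ laurentNonneg κ) :
    ∃ f ∈ 𝒟 0, ρ f ≠ 0 ∧ ∃ G : Matrix σ σ D[T;T⁻¹], IsGradedMatrix (laurentGrading 𝒟 l) δ δ G ∧
      (∀ i j, ∀ k > 0, (G i j).coeff k = 0) ∧
      (∀ i j, (G i j).coeff 0 = if i = j then f else 0) ∧
      ∀ i j, (V * G) i j ∈ laurentNonneg D := by
  obtain ⟨N, hN⟩ := exists_T_mul_mem_laurentNonneg fun x : ι × σ => V x.1 x.2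
  set V₁ : Matrix ι σ D[T;T⁻¹] := V.map (filterCoeff (0 ≤ ·)) with hV₁
  have hV₁gr : IsGradedMatrix (laurentGrading 𝒟 l) d δ V₁ := fun i j =>
    filterCoeff_mem_laurentGrading _ (h.graded_left i j)
  have hV₁n : ∀ i j, V₁ i j ∈ laurentNonneg D := fun i j => by
    rw [mem_laurentNonneg]
    intro k hk
    rw [hV₁, Matrix.map_apply, coeff_filterCoeff, if_neg (by omega)]
  have hV₁m : V₁.map (mapCoeff ρ) = V.map (mapCoeff ρ) := by
    ext i j k
    rw [Matrix.map_apply, Matrix.map_apply, coeff_mapCoeff, hV₁, Matrix.map_apply,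
      coeff_filterCoeff]
    split_ifs with hk
    · rw [coeff_mapCoeff]
    · rw [mem_laurentNonneg.1 (hV i j) k (by omega), map_zero]
  set Y := W * V₁ with hY
  have hYgr : IsGradedMatrix (laurentGrading 𝒟 l) δ δ Y := h.graded_right.mul hV₁gr
  have hYm : Y.map (mapCoeff ρ) = (C (ρ g) : κ[T;T⁻¹]) • (1 : Matrix σ σ κ[T;T⁻¹]) := by
    rw [hY, Matrix.map_mul, hV₁m, ← Matrix.map_mul, h.mul_eq_one]
    ext1 i j
    by_cases hij : i = j
    · subst hij
      simp [mapCoeff_C]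
    · simp [Matrix.one_apply_ne hij]
  have hVY : ∀ i j, (V * Y) i j ∈ laurentNonneg D := fun i j => by
    rw [hY, ← Matrix.mul_assoc, h.mul_eq, Matrix.smul_mul, Matrix.smul_apply, smul_eq_mul,
      Matrix.mul_apply]
    exact mul_mem (C_mem_laurentNonneg _) (sum_mem fun x _ => mul_mem (hE _ _) (hV₁n _ _))
  let τ := σ × Fin (N + 1)
  let Tm : Matrix τ τ D := fun x y => (Y x.1 y.1).coeff ((x.2 : ℤ) - (y.2 : ℤ))
  have hTm : IsGradedMatrix 𝒟 (fun x : τ => δ x.1 - (x.2 : ℤ) • l)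
      (fun x : τ => δ x.1 - (x.2 : ℤ) • l) Tm := fun x y => by
    have := hYgr x.1 y.1 ((x.2 : ℤ) - (y.2 : ℤ))
    rwa [show δ x.1 - δ y.1 - ((x.2 : ℤ) - (y.2 : ℤ)) • l =
      δ x.1 - (x.2 : ℤ) • l - (δ y.1 - (y.2 : ℤ) • l) by rw [sub_smul]; abel] at this
  have hTmρ : Tm.map ρ = ρ g • (1 : Matrix τ τ κ) := by
    ext x y
    have h1 := congrArg (fun M : Matrix σ σ κ[T;T⁻¹] =>
      (M x.1 y.1).coeff ((x.2 : ℤ) - (y.2 : ℤ))) hYm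
    simp only [Matrix.map_apply, coeff_mapCoeff] at h1
    rw [Matrix.map_apply, h1, Matrix.smul_apply, Matrix.smul_apply, smul_eq_mul, smul_eq_mul,
      coeff_C_mul, Matrix.one_apply, Matrix.one_apply]
    congr 1
    by_cases hxy : x = y
    · subst hxy
      rw [if_pos rfl, if_pos rfl, sub_self, ← map_one C, C_apply, if_pos rfl]
    · rw [if_neg hxy]
      split_ifs with h2
      · rw [← map_one C, C_apply, if_neg]
        intro h3
        refine hxy (Prod.ext h2 (Fin.ext ?_))
        omega
      · simp
  let Q : Matrix σ σ D[T;T⁻¹] := fun i i₀ =>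
    ∑ j : Fin (N + 1), T (j : ℤ) * C (Tm.adjugate (i, j) (i₀, 0))
  have hQgr : IsGradedMatrix (laurentGrading 𝒟 l) δ δ Q := fun i i₀ => by
    refine sum_mem fun j _ => ?_
    have := T_mul_mem_laurentGrading
      (C_mem_laurentGrading (l := l) (hTm.adjugate (i, j) (i₀, 0))) (j : ℤ)
    convert this using 2
    simp only [Fin.val_zero, Nat.cast_zero, zero_smul, sub_zero]
    abel
  have hQn : ∀ i i₀, Q i i₀ ∈ laurentNonneg D := fun i i₀ =>
    sum_mem fun j _ => mul_mem (T_mem_laurentNonneg (Int.natCast_nonneg _)) (C_mem_laurentNonneg _)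
  have hYQ : ∀ i i₀, ∀ j : Fin (N + 1), ((Y * Q) i i₀).coeff (j : ℤ) =
      if (i, j) = (i₀, 0) then Tm.det else 0 := fun i i₀ j => by
    have h1 : (Tm * Tm.adjugate) (i, j) (i₀, 0) = if (i, j) = (i₀, 0) then Tm.det else 0 := by
      rw [Matrix.mul_adjugate, Matrix.smul_apply, Matrix.one_apply, smul_eq_mul, mul_ite, mul_one,
        mul_zero]
    rw [← h1, Matrix.mul_apply, Matrix.mul_apply, coeff_sum_apply, Fintype.sum_prod_type]
    refine Finset.sum_congr rfl fun i' _ => ?_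
    rw [Finset.mul_sum, coeff_sum_apply]
    refine Finset.sum_congr rfl fun j' _ => ?_
    rw [mul_comm, mul_assoc, coeff_T_mul, coeff_C_mul, mul_comm]
  refine ⟨Tm.det, ?_, ?_, (Y * Q).map (filterCoeff (· ≤ (N : ℤ))), ?_, ?_, ?_, ?_⟩
  · simpa using hTm.det_mem
  · have : ρ Tm.det = (Tm.map ρ).det := RingHom.map_det ρ Tm
    rw [this, hTmρ, Matrix.det_smul, Matrix.det_one, mul_one]
    exact pow_ne_zero _ hg0
  · exact fun i j => filterCoeff_mem_laurentGrading _ (hYgr.mul hQgr i j)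
  · intro i j k hk
    rw [Matrix.map_apply, coeff_filterCoeff]
    split_ifs with hkN
    · obtain ⟨n, rfl⟩ := Int.eq_ofNat_of_zero_le hk.le
      have := hYQ i j ⟨n, by omega⟩
      rw [if_neg] at this
      · exact this
      · intro hh
        have h2 := congrArg Fin.val (Prod.ext_iff.1 hh).2
        simp at h2
        omega
    · rfl
  · intro i j
    rw [Matrix.map_apply, coeff_filterCoeff, if_pos (Int.natCast_nonneg N)]
    have := hYQ i j 0
    simpa using this
  · intro i j
    have h1 : (V * (Y * Q).map (filterCoeff (· ≤ (N : ℤ)))) i j = (V * Y * Q) i j -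
        ∑ x, T (N : ℤ) * V i x * (T (-(N : ℤ)) * filterCoeff ((N : ℤ) < ·) ((Y * Q) x j)) := by
      rw [Matrix.mul_assoc V Y, Matrix.mul_apply, Matrix.mul_apply, ← Finset.sum_sub_distrib]
      refine Finset.sum_congr rfl fun x _ => ?_
      rw [mul_mul_mul_comm, ← T_add, add_neg_cancel, T_zero, one_mul, ← mul_sub, Matrix.map_apply]
      congr 1
      ext k
      rw [AddMonoidAlgebra.coeff_sub, Finsupp.sub_apply, coeff_filterCoeff, coeff_filterCoeff]
      split_ifs <;> first | omega | simp
    rw [h1, Matrix.mul_apply]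
    refine sub_mem (sum_mem fun x _ => mul_mem (hVY _ _) (hQn _ _))
      (sum_mem fun x _ => mul_mem (hN (i, x)) ?_)
    rw [mem_laurentNonneg]
    intro k hk
    rw [coeff_T_mul, coeff_filterCoeff, if_neg (by omega)]

end

end

section

open LaurentPolynomial Matrix
open scoped Polynomial

namespace LaurentPolynomial

variable {D : Type*} [CommRing D]

theorem coeff_mul_of_nonpos {f g : D[T;T⁻¹]} (hf : ∀ k > 0, f.coeff k = 0)
    (hg : ∀ k > 0, g.coeff k = 0) :
    (∀ k > 0, (f * g).coeff k = 0) ∧ (f * g).coeff 0 = f.coeff 0 * g.coeff 0 := by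
  have h : ∀ {f : D[T;T⁻¹]}, (∀ k > 0, f.coeff k = 0) → invert f ∈ laurentNonneg D := fun hf =>
    mem_laurentNonneg.2 fun k hk => by
      rw [invert_apply]
      exact hf _ (by omega)
  have h0 : ∀ f : D[T;T⁻¹], f.coeff 0 = (invert f).coeff 0 := fun f => by
    rw [invert_apply, neg_zero]
  constructor
  · intro k hk
    have := mem_laurentNonneg.1 (mul_mem (h hf) (h hg)) (-k) (by omega)
    rwa [← map_mul, invert_apply, neg_neg] at this
  · obtain ⟨p, hp⟩ := h hf
    obtain ⟨q, hq⟩ := h hg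
    change Polynomial.toLaurent p = _ at hp
    change Polynomial.toLaurent q = _ at hq
    rw [h0, h0 f, h0 g, map_mul, ← hp, ← hq, ← map_mul]
    have := Polynomial.mul_coeff_zero p q
    rwa [← coeff_toLaurent_natCast, ← coeff_toLaurent_natCast, ← coeff_toLaurent_natCast] at this

end LaurentPolynomial

theorem IsGradedFactorization.exists_mem_laurentNonneg
    {P R D κ ι σ : Type*} [AddCommGroup P] [CommRing R] [CommRing D] [Algebra R D]
    [IsDomain D] [Field κ] {𝒟 : P → Submodule R D} [SetLike.GradedMonoid 𝒟] {l : P}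
    [Fintype ι] [Fintype σ] [DecidableEq σ] {ρ : D →+* κ}
    (hρ : ∀ p, ∀ a ∈ 𝒟 p, ρ a ≠ 0 → ∃ b ∈ 𝒟 (-p), ρ (a * b) ≠ 0) {d : ι → P}
    {E : Matrix ι ι D[T;T⁻¹]} (hE : ∀ i j, E i j ∈ laurentNonneg D)
    {δ : σ → P} {V : Matrix ι σ D[T;T⁻¹]} {W : Matrix σ ι D[T;T⁻¹]} {g : D} (hg : g ∈ 𝒟 0)
    (hg0 : ρ g ≠ 0) (h : IsGradedFactorization (laurentGrading 𝒟 l) d E δ V W (C g)) :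
    ∃ (δ' : σ → P) (V' : Matrix ι σ D[T;T⁻¹]) (W' : Matrix σ ι D[T;T⁻¹]) (g' : D),
      g' ∈ 𝒟 0 ∧ ρ g' ≠ 0 ∧ IsGradedFactorization (laurentGrading 𝒟 l) d E δ' V' W' (C g') ∧
      (∀ i j, V' i j ∈ laurentNonneg D) ∧ ∀ j i, W' j i ∈ laurentNonneg D := by
  obtain ⟨δ, V, W, g, hg, hg0, h, hV, hW⟩ :=
    h.exists_nonneg hρ (fun i j => mapCoeff_mem_laurentNonneg ρ (hE i j)) hg hg0
  obtain ⟨f, hf, hf0, G, hG, hG1, hG2, hVG⟩ := h.exists_mul_nonneg hE hg0 hV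
  obtain ⟨f', hf', hf0', G', hG', hG1', hG2', hWG⟩ :=
    h.transpose.exists_mul_nonneg (fun i j => hE j i) hg0 (fun i j => hW j i)
  have hH : IsGradedMatrix (laurentGrading 𝒟 l) δ δ G'.transpose := by
    simpa using hG'.transpose
  have hHW : ∀ i j, (G'.transpose * W) i j ∈ laurentNonneg D := fun i j => by
    have := hWG j i
    rwa [← Matrix.transpose_apply (W.transpose * G'), Matrix.transpose_mul,
      Matrix.transpose_transpose] at this
  have hgne : g ≠ 0 := fun h0 => hg0 (by rw [h0, map_zero])
  have hffne : f' * f ≠ 0 := fun h0 => by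
    have := mul_ne_zero hf0' hf0
    rw [← map_mul, h0, map_zero] at this
    exact this rfl
  have hprod : G'.transpose * W * (V * G) = (C g : D[T;T⁻¹]) • (G'.transpose * G) := by
    rw [Matrix.mul_assoc, ← Matrix.mul_assoc W, h.mul_eq_one, Matrix.smul_mul, Matrix.one_mul,
      Matrix.mul_smul]
  have hHG : G'.transpose * G = (C (f' * f) : D[T;T⁻¹]) • 1 := by
    ext i j k
    rcases lt_trichotomy k 0 with hk | hk | hk
    · have h1 : ((G'.transpose * W * (V * G)) i j) ∈ laurentNonneg D := by
        rw [Matrix.mul_apply]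
        exact sum_mem fun x _ => mul_mem (hHW _ _) (hVG _ _)
      rw [hprod, Matrix.smul_apply, smul_eq_mul] at h1
      have h2 := mem_laurentNonneg.1 h1 k hk
      rw [coeff_C_mul] at h2
      rw [(mul_eq_zero.1 h2).resolve_left hgne, Matrix.smul_apply, smul_eq_mul, coeff_C_mul,
        Matrix.one_apply]
      split_ifs
      · rw [← map_one C, C_apply, if_neg (by omega), mul_zero]
      · simp
    · subst hk
      rw [Matrix.mul_apply, coeff_sum_apply, Matrix.smul_apply, smul_eq_mul, coeff_C_mul]
      have : ∀ x ∈ Finset.univ, (G'.transpose i x * G x j).coeff 0 =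
          if x = i then (if i = j then f' * f else 0) else 0 := fun x _ => by
        rw [Matrix.transpose_apply, (coeff_mul_of_nonpos (hG1' x i) (hG1 x j)).2, hG2', hG2]
        by_cases h1 : x = i
        · subst h1
          simp
        · simp [h1]
      rw [Finset.sum_congr rfl this, Finset.sum_ite_eq', if_pos (Finset.mem_univ _),
        Matrix.one_apply]
      split_ifs
      · rw [← map_one C, C_apply, if_pos rfl, mul_one]
      · simp
    · rw [Matrix.mul_apply, coeff_sum_apply, Finset.sum_eq_zero, Matrix.smul_apply, smul_eq_mul,
        coeff_C_mul, Matrix.one_apply]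
      · split_ifs
        · rw [← map_one C, C_apply, if_neg (by omega), mul_zero]
        · simp
      · exact fun x _ => (coeff_mul_of_nonpos (fun k hk => hG1' x i k hk) (hG1 x j)).1 k hk
  have hCne : (C (f' * f) : D[T;T⁻¹]) ≠ 0 := fun h0 => by
    have := congrArg (fun f : D[T;T⁻¹] => f.coeff 0) h0
    simp only [C_apply, if_true] at this
    exact hffne (by simpa using this)
  have hGH := Matrix.mul_eq_smul_one_symm hCne hHG
  refine ⟨δ, V * G, G'.transpose * W, g * (f' * f), ?_, ?_, ⟨h.graded_left.mul hG,
    hH.mul h.graded_right, ?_, ?_⟩, hVG, hHW⟩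
  · have := SetLike.GradedMul.mul_mem hg (SetLike.GradedMul.mul_mem hf' hf)
    rwa [zero_add, zero_add] at this
  · rw [map_mul, map_mul]
    exact mul_ne_zero hg0 (mul_ne_zero hf0' hf0)
  · rw [Matrix.mul_assoc, ← Matrix.mul_assoc G, hGH, Matrix.smul_mul, Matrix.one_mul,
      Matrix.mul_smul, h.mul_eq, smul_smul, ← map_mul, mul_comm g]
  · rw [hprod, hHG, smul_smul, ← map_mul]

end

section

open Matrix Polynomial
open scoped LaurentPolynomial

section

variable {P R D : Type*} [AddCommGroup P] [CommRing R] [CommRing D] [Algebra R D]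

/-- The grading of `D[X]` in which `X` has degree `l`. -/
noncomputable def polynomialGrading (𝒟 : P → Submodule R D) (l : P) (p : P) :
    Submodule R D[X] where
  carrier := {f | ∀ k : ℕ, f.coeff k ∈ 𝒟 (p - k • l)}
  zero_mem' := fun k => by simp
  add_mem' := fun hf hg k => by simpa using add_mem (hf k) (hg k)
  smul_mem' := fun r f hf k => by simpa using Submodule.smul_mem _ r (hf k)

variable {𝒟 : P → Submodule R D} {l : P}

theorem mem_polynomialGrading {p : P} {f : D[X]} :
    f ∈ polynomialGrading 𝒟 l p ↔ ∀ k : ℕ, f.coeff k ∈ 𝒟 (p - k • l) := Iff.rfl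

theorem toLaurent_mem_laurentGrading {p : P} {f : D[X]} :
    toLaurent f ∈ laurentGrading 𝒟 l p ↔ f ∈ polynomialGrading 𝒟 l p := by
  constructor
  · intro h k
    have := h (k : ℤ)
    rwa [LaurentPolynomial.coeff_toLaurent_natCast, natCast_zsmul] at this
  · intro h k
    rcases lt_or_ge k 0 with hk | hk
    · rw [LaurentPolynomial.coeff_toLaurent_of_neg _ hk]
      exact zero_mem _
    · obtain ⟨n, rfl⟩ := Int.eq_ofNat_of_zero_le hk
      rw [LaurentPolynomial.coeff_toLaurent_natCast, natCast_zsmul]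
      exact h n

theorem C_coeff_zero_mem_polynomialGrading {p : P} {f : D[X]} (h : f ∈ polynomialGrading 𝒟 l p) :
    C (f.coeff 0) ∈ polynomialGrading 𝒟 l p := fun k => by
  rw [coeff_C]
  split_ifs with hk
  · rw [hk]
    exact h 0
  · exact zero_mem _

theorem C_mem_polynomialGrading {a : D} {p : P} (ha : a ∈ 𝒟 p) :
    C a ∈ polynomialGrading 𝒟 l p := fun k => by
  rw [coeff_C]
  split_ifs with hk
  · rw [hk, zero_smul, sub_zero]
    exact ha
  · exact zero_mem _

/-- The matrix of constant terms of a matrix of polynomials, again as a matrix of polynomials. -/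
noncomputable def Matrix.constTerm {ι κ D : Type*} [CommRing D] (M : Matrix ι κ D[X]) :
    Matrix ι κ D[X] :=
  M.map (C.comp constantCoeff)

theorem IsGradedMatrix.constTerm {ι κ : Type*} {d : ι → P} {d' : κ → P} {M : Matrix ι κ D[X]}
    (hM : IsGradedMatrix (polynomialGrading 𝒟 l) d d' M) :
    IsGradedMatrix (polynomialGrading 𝒟 l) d d' M.constTerm := fun i j =>
  C_coeff_zero_mem_polynomialGrading (hM i j)

variable [SetLike.GradedMonoid 𝒟]

instance : SetLike.GradedMonoid (polynomialGrading 𝒟 l) where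
  one_mem := by
    rw [← toLaurent_mem_laurentGrading, map_one]
    exact SetLike.GradedOne.one_mem
  mul_mem := fun p q f g hf hg => by
    rw [← toLaurent_mem_laurentGrading] at hf hg ⊢
    rw [map_mul]
    exact SetLike.GradedMul.mul_mem hf hg

variable {ι : Type*} [Fintype ι]

theorem exists_local_conj_constTerm {κ σ : Type*} [Fintype σ] [DecidableEq σ] [Field κ]
    [IsDomain D] {ρ : D →+* κ}
    (hρ : ∀ p, ∀ a ∈ 𝒟 p, ρ a ≠ 0 → ∃ b ∈ 𝒟 (-p), ρ (a * b) ≠ 0) {d : ι → P}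
    {e : Matrix ι ι D[X]}
    {δ : σ → P} {V : Matrix ι σ D[T;T⁻¹]} {W : Matrix σ ι D[T;T⁻¹]} {g : D} (hg : g ∈ 𝒟 0)
    (hg0 : ρ g ≠ 0) (h : IsGradedFactorization (laurentGrading 𝒟 l) d (e.map toLaurent) δ V W
      (LaurentPolynomial.C g)) :
    ∃ f ∈ 𝒟 0, ρ f ≠ 0 ∧ ∃ u v : Matrix ι ι D[X],
      IsGradedMatrix (polynomialGrading 𝒟 l) d d u ∧ IsGradedMatrix (polynomialGrading 𝒟 l) d d v ∧
      u * v = C f • e ∧ v * u = C f • e.constTerm ∧ e * u = u ∧ u * e.constTerm = u ∧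
      v * e = v ∧ e.constTerm * v = v := by
  obtain ⟨δ, V, W, g, hg, hg0, h, hV, hW⟩ := h.exists_mem_laurentNonneg (E := e.map toLaurent) hρ
    (fun i j => ⟨e i j, rfl⟩) hg hg0
  choose V' hV' using hV
  choose W' hW' using hW
  obtain rfl : Matrix.map (Matrix.of V') toLaurent = V := by ext1 i j; exact hV' i j
  obtain rfl : Matrix.map (Matrix.of W') toLaurent = W := by ext1 i j; exact hW' i j
  generalize Matrix.of V' = V at *
  generalize Matrix.of W' = W at *
  have hgne : (C g : D[X]) ≠ 0 := fun h0 => hg0 (by rw [C_eq_zero.1 h0, map_zero])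
  have hVgr : IsGradedMatrix (polynomialGrading 𝒟 l) d δ V := fun i j =>
    toLaurent_mem_laurentGrading.1 (h.graded_left i j)
  have hWgr : IsGradedMatrix (polynomialGrading 𝒟 l) δ d W := fun i j =>
    toLaurent_mem_laurentGrading.1 (h.graded_right i j)
  have hVW : V * W = C g • e := by
    refine Matrix.map_injective (toLaurent_injective (R := D)) ?_
    change (V * W).map toLaurent = (C g • e).map toLaurent
    rw [Matrix.map_mul, h.mul_eq]
    ext1 i j
    simp
  have hWV : W * V = C g • 1 := by
    refine Matrix.map_injective (toLaurent_injective (R := D)) ?_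
    change (W * V).map toLaurent = (C g • (1 : Matrix _ _ D[X])).map toLaurent
    rw [Matrix.map_mul, h.mul_eq_one]
    ext1 i j
    by_cases hij : i = j
    · subst hij
      simp
    · simp [Matrix.one_apply_ne hij]
  have hVW0 : V.constTerm * W.constTerm = C g • e.constTerm := by
    rw [Matrix.constTerm, Matrix.constTerm, ← Matrix.map_mul, hVW]
    ext1 i j
    simp [Matrix.constTerm]
  have hWV0 : W.constTerm * V.constTerm = C g • 1 := by
    rw [Matrix.constTerm, Matrix.constTerm, ← Matrix.map_mul, hWV]
    ext1 i j
    by_cases hij : i = j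
    · subst hij
      simp
    · simp [Matrix.one_apply_ne hij]
  have heV : e * V = V := by
    refine smul_right_injective _ hgne ?_
    change C g • (e * V) = C g • V
    rw [← Matrix.smul_mul, ← hVW, Matrix.mul_assoc, hWV, Matrix.mul_smul, Matrix.mul_one]
  have hWe : W * e = W := by
    refine smul_right_injective _ hgne ?_
    change C g • (W * e) = C g • W
    rw [← Matrix.mul_smul, ← hVW, ← Matrix.mul_assoc, hWV, Matrix.smul_mul, Matrix.one_mul]
  have heV0 : e.constTerm * V.constTerm = V.constTerm := by
    rw [Matrix.constTerm, Matrix.constTerm, ← Matrix.map_mul, heV]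
  have hWe0 : W.constTerm * e.constTerm = W.constTerm := by
    rw [Matrix.constTerm, Matrix.constTerm, ← Matrix.map_mul, hWe]
  refine ⟨g * g, ?_, ?_, V * W.constTerm, V.constTerm * W, hVgr.mul hWgr.constTerm,
    hVgr.constTerm.mul hWgr, ?_, ?_, ?_, ?_, ?_, ?_⟩
  · have := SetLike.GradedMul.mul_mem hg hg
    rwa [zero_add] at this
  · rw [map_mul]
    exact mul_ne_zero hg0 hg0
  · rw [Matrix.mul_assoc, ← Matrix.mul_assoc W.constTerm, hWV0, Matrix.smul_mul, Matrix.one_mul,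
      Matrix.mul_smul, hVW, smul_smul, ← map_mul]
  · rw [Matrix.mul_assoc, ← Matrix.mul_assoc W, hWV, Matrix.smul_mul, Matrix.one_mul,
      Matrix.mul_smul, hVW0, smul_smul, ← map_mul]
  · rw [← Matrix.mul_assoc, heV]
  · rw [Matrix.mul_assoc, hWe0]
  · rw [Matrix.mul_assoc, hWe]
  · rw [← Matrix.mul_assoc, heV0]

end

end

section

open Matrix Polynomial
open scoped LaurentPolynomial

section

variable {P R D ι : Type*} [AddCommGroup P] [DecidableEq P] [CommRing R] [CommRing D]
  [Algebra R D] [Fintype ι] [DecidableEq ι] {l : P}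

/-- The ring of homogeneous endomorphisms of a graded free `D[X]`-module with basis in the
degrees `d`. -/
noncomputable def gradedMatrixSubalgebra (𝒟 : P → Submodule R D) [GradedAlgebra 𝒟] (l : P)
    (d : ι → P) : Subalgebra (𝒟 0) (Matrix ι ι D[X]) where
  carrier := {M | IsGradedMatrix (polynomialGrading 𝒟 l) d d M}
  mul_mem' := fun hM hN => hM.mul hN
  add_mem' := fun hM hN => hM.add hN
  algebraMap_mem' := fun c => by
    rw [Algebra.algebraMap_eq_smul_one]
    have h : c • (1 : Matrix ι ι D[X]) = C (c : D) • (1 : Matrix ι ι D[X]) := by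
      ext1 i j
      rw [Matrix.smul_apply, Matrix.smul_apply, smul_eq_mul, ← smul_eq_C_mul]
      rfl
    change IsGradedMatrix _ _ _ _
    rw [h]
    exact (IsGradedMatrix.one d).smul (C_mem_polynomialGrading c.2)

theorem exists_conj_constTerm [IsDomain D] {𝒟 : P → Submodule R D} [GradedAlgebra 𝒟] {d : ι → P}
    (H : ∀ m : Ideal (𝒟 0), m.IsMaximal → ∀ E : Matrix ι ι D[T;T⁻¹], E * E = E →
      IsGradedMatrix (laurentGrading 𝒟 l) d d E → ∃ (s : ℕ) (δ : Fin s → P)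
        (V : Matrix ι (Fin s) D[T;T⁻¹]) (W : Matrix (Fin s) ι D[T;T⁻¹]) (g : 𝒟 0), g ∉ m ∧
        IsGradedFactorization (laurentGrading 𝒟 l) d E δ V W (LaurentPolynomial.C (g : D)))
    {e : Matrix ι ι D[X]} (he : e * e = e) (hgr : IsGradedMatrix (polynomialGrading 𝒟 l) d d e) :
    ∃ u v : Matrix ι ι D[X], IsGradedMatrix (polynomialGrading 𝒟 l) d d u ∧
      IsGradedMatrix (polynomialGrading 𝒟 l) d d v ∧ u * v = 1 ∧ v * u = 1 ∧
      e * u = u * e.constTerm := by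
  let S := gradedMatrixSubalgebra 𝒟 l d
  have hcomp : ∀ a : 𝒟 0, ∀ M ∈ S, (compRingHom (C (a : D) * X)).mapMatrix M ∈ S :=
    fun a M hM i j k => by
      rw [RingHom.mapMatrix_apply, Matrix.map_apply, coe_compRingHom_apply, comp_C_mul_X_coeff]
      have h1 : (a : D) ^ k ∈ 𝒟 0 := (a ^ k).2
      have := SetLike.GradedMul.mul_mem (hM i j k) h1
      rwa [add_zero] at this
  let φ : 𝒟 0 → S →+* S := fun a =>
    ((compRingHom (C (a : D) * X)).mapMatrix.comp S.subtype).codRestrict S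
      fun M => hcomp a M M.2
  have hφc : ∀ a : 𝒟 0, ∀ M : S, ∀ i j, ∀ k,
      ((φ a M : Matrix ι ι D[X]) i j).coeff k = ((M : Matrix ι ι D[X]) i j).coeff k * (a : D) ^ k :=
    fun a M i j k => by
      change (((compRingHom (C (a : D) * X)).mapMatrix (M : Matrix ι ι D[X])) i j).coeff k = _
      rw [RingHom.mapMatrix_apply, Matrix.map_apply, coe_compRingHom_apply, comp_C_mul_X_coeff]
  have hsc : ∀ c : 𝒟 0, ∀ M : S, ∀ i j, ∀ k, (((c • M : S) : Matrix ι ι D[X]) i j).coeff k =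
      (c : D) * ((M : Matrix ι ι D[X]) i j).coeff k := fun c M i j k => rfl
  have hext : ∀ M N : S, (∀ i j k, ((M : Matrix ι ι D[X]) i j).coeff k =
      ((N : Matrix ι ι D[X]) i j).coeff k) → M = N := fun M N h =>
    Subtype.ext (Matrix.ext fun i j => Polynomial.ext fun k => h i j k)
  have hscal : ∀ (c : 𝒟 0) (M : Matrix ι ι D[X]) (hM : M ∈ S), 
      C (c : D) • M = ((c • (⟨M, hM⟩ : S) : S) : Matrix ι ι D[X]) := fun c M hM => by
    ext1 i j
    rw [Matrix.smul_apply, smul_eq_mul, ← smul_eq_C_mul]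
    rfl
  let e' : S := ⟨e, hgr⟩
  have h0 : ((φ 0 e' : S) : Matrix ι ι D[X]) = e.constTerm := by
    ext i j k
    rw [hφc, Matrix.constTerm, Matrix.map_apply, RingHom.comp_apply, coeff_C]
    split_ifs with hk
    · subst hk
      simp [e']
    · simp [hk]
  suffices hS : ∃ u v : S, u * v = 1 ∧ v * u = 1 ∧ e' * u = u * φ 0 e' by
    obtain ⟨u, v, huv, hvu, heu⟩ := hS
    refine ⟨u, v, u.2, v.2, congrArg Subtype.val huv, congrArg Subtype.val hvu, ?_⟩
    rw [← h0]
    exact congrArg Subtype.val heu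
  refine exists_conj_of_locally_conj φ ?_ ?_ ?_ e' (φ 0 e') ?_ rfl ?_ ?_
  · intro a c
    rw [Algebra.algebraMap_eq_smul_one]
    refine hext _ _ fun i j k => ?_
    rw [hφc, hsc]
    by_cases hk : k = 0
    · subst hk
      rw [pow_zero, mul_one]
    · have : (((1 : S) : Matrix ι ι D[X]) i j).coeff k = 0 := by
        change ((1 : Matrix ι ι D[X]) i j).coeff k = 0
        rw [Matrix.one_apply]
        split_ifs
        · rw [coeff_one, if_neg hk]
        · rw [coeff_zero]
      rw [this, mul_zero, zero_mul]
  · intro a b c s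
    have hq : ∀ k : ℕ, ∃ q : 𝒟 0, (a + c * b) ^ k - a ^ k = c * q := fun k => by
      have h1 := sub_dvd_pow_sub_pow (a + c * b) a k
      rw [add_sub_cancel_left] at h1
      exact (dvd_mul_right c b).trans h1
    choose q hq using hq
    let t : Matrix ι ι D[X] := fun i j =>
      ∑ k ∈ Finset.range (((s : Matrix ι ι D[X]) i j).natDegree + 1),
        monomial k (((s : Matrix ι ι D[X]) i j).coeff k * (q k : D))
    have ht : ∀ i j k, (t i j).coeff k = ((s : Matrix ι ι D[X]) i j).coeff k * (q k : D) :=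
      fun i j k => by
        simp only [t, finsetSum_coeff, coeff_monomial, Finset.sum_ite_eq']
        split_ifs with hk
        · rfl
        · rw [coeff_eq_zero_of_natDegree_lt (by simpa using hk), zero_mul]
    have htS : t ∈ S := fun i j k => by
      rw [ht]
      have := SetLike.GradedMul.mul_mem (s.2 i j k) (q k).2
      rwa [add_zero] at this
    refine ⟨⟨t, htS⟩, hext _ _ fun i j k => ?_⟩
    rw [hsc]
    change ((φ (a + c * b) s : Matrix ι ι D[X]) i j - (φ a s : Matrix ι ι D[X]) i j).coeff k =
      (c : D) * (t i j).coeff k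
    have h1 : ((a + c * b : 𝒟 0) : D) ^ k - (a : D) ^ k = (c : D) * (q k : D) :=
      congrArg Subtype.val (hq k)
    rw [coeff_sub, hφc, hφc, ← mul_sub, h1, ht]
    ring
  · intro c hc s hs
    refine hext _ _ fun i j k => ?_
    have h1 := hsc c s i j k
    rw [hs] at h1
    have hc' : (c : D) ≠ 0 := fun h => hc (Subtype.ext h)
    exact (mul_eq_zero.1 h1.symm).resolve_left hc'
  · intro a
    refine hext _ _ fun i j k => ?_
    rw [hφc, hφc]
    by_cases hk : k = 0
    · subst hk
      simp
    · simp [hk]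
  · refine hext _ _ fun i j k => ?_
    rw [hφc]
    simp
  · intro m hm
    obtain ⟨n, hn, hnm, hn'⟩ := exists_isMaximal_graded_lift 𝒟 m hm
    let _ : Field (D ⧸ n) := Ideal.Quotient.field n
    let ρ : D →+* D ⧸ n := Ideal.Quotient.mk n
    have hρ0 : ∀ a, ρ a ≠ 0 ↔ a ∉ n := fun a => not_congr Ideal.Quotient.eq_zero_iff_mem
    have hρ : ∀ p, ∀ a ∈ 𝒟 p, ρ a ≠ 0 → ∃ b ∈ 𝒟 (-p), ρ (a * b) ≠ 0 := fun p a ha h => by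
      obtain ⟨b, hb, hab⟩ := hn' p a ha ((hρ0 _).1 h)
      exact ⟨b, hb, (hρ0 _).2 hab⟩
    have key : ∀ e : Matrix ι ι D[X], e * e = e → IsGradedMatrix (polynomialGrading 𝒟 l) d d e →
        ∃ f : 𝒟 0, f ∉ m ∧ ∃ u v : Matrix ι ι D[X],
          IsGradedMatrix (polynomialGrading 𝒟 l) d d u ∧
          IsGradedMatrix (polynomialGrading 𝒟 l) d d v ∧
          u * v = C (f : D) • e ∧ v * u = C (f : D) • e.constTerm ∧ e * u = u ∧
          u * e.constTerm = u ∧ v * e = v ∧ e.constTerm * v = v := fun e he hgr => by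
      obtain ⟨s, δ, V, W, g, hgm, h⟩ := H m hm (e.map toLaurent)
        (by rw [← Matrix.map_mul, he]) fun i j => toLaurent_mem_laurentGrading.2 (hgr i j)
      obtain ⟨f, hf, hf0, h'⟩ := exists_local_conj_constTerm hρ g.2
        ((hρ0 _).2 fun h => hgm ((hnm g).1 h)) h
      exact ⟨⟨f, hf⟩, fun h => (hρ0 _).1 hf0 ((hnm ⟨f, hf⟩).2 h), h'⟩
    obtain ⟨f, hf, u, v, hu, hv, huv, hvu, heu, hue, hve, hev⟩ := key e he hgr
    obtain ⟨f', hf', u', v', hu', hv', huv', hvu', heu', hue', hve', hev'⟩ := key (1 - e)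
      (by rw [mul_sub, mul_one, sub_mul, one_mul, he, sub_self, sub_zero])
      ((IsGradedMatrix.one d).sub hgr)
    have h1e : (1 - e).constTerm = 1 - e.constTerm := by
      rw [Matrix.constTerm, Matrix.constTerm, ← RingHom.mapMatrix_apply, ← RingHom.mapMatrix_apply,
        map_sub, map_one]
    rw [h1e] at hvu' hue' hev'
    have he0 : e.constTerm * e.constTerm = e.constTerm := by
      rw [Matrix.constTerm, ← Matrix.map_mul, he]
    have hff : f * f' ∉ m := fun h => (hm.isPrime.mem_or_mem h).elim hf hf'
    have huv0 : u * v' = 0 := by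
      rw [← hue, ← hev', mul_assoc, ← mul_assoc e.constTerm, mul_sub, mul_one, he0, sub_self,
        zero_mul, mul_zero]
    have huv0' : u' * v = 0 := by
      rw [← hue', ← hev, mul_assoc, ← mul_assoc (1 - e.constTerm), sub_mul, one_mul, he0, sub_self,
        zero_mul, mul_zero]
    have hvu0 : v * u' = 0 := by
      rw [← hve, ← heu', mul_assoc, ← mul_assoc e, mul_sub, mul_one, he, sub_self,
        zero_mul, mul_zero]
    have hvu0' : v' * u = 0 := by
      rw [← hve', ← heu, mul_assoc, ← mul_assoc (1 - e), sub_mul, one_mul, he, sub_self,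
        zero_mul, mul_zero]
    have hone : (1 : Matrix ι ι D[X]) ∈ S := one_mem S
    let w : S := ⟨v, hv⟩
    let w' : S := ⟨v', hv'⟩
    have hw : ((f' • w : S) : Matrix ι ι D[X]) = C (f' : D) • v := (hscal _ _ _).symm
    have hw' : ((f • w' : S) : Matrix ι ι D[X]) = C (f : D) • v' := (hscal _ _ _).symm
    refine ⟨f * f', hff, fun h => hff (h ▸ zero_mem _), ⟨u + u', hu.add hu'⟩,
      f' • w + f • w', ?_, ?_, ?_⟩
    · rw [Algebra.algebraMap_eq_smul_one]
      apply Subtype.ext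
      have h2 : (((f * f') • (1 : S) : S) : Matrix ι ι D[X]) = C ((f * f' : 𝒟 0) : D) • 1 :=
        (hscal _ _ hone).symm
      rw [h2]
      change (u + u') * (((f' • w : S) : Matrix ι ι D[X]) + ((f • w' : S) : Matrix ι ι D[X])) = _
      rw [hw, hw', mul_add, add_mul, add_mul, Matrix.mul_smul, Matrix.mul_smul,
        Matrix.mul_smul, Matrix.mul_smul, huv, huv', huv0, huv0', smul_zero, smul_zero, add_zero,
        zero_add, smul_smul, smul_smul, ← map_mul, ← map_mul, mul_comm (f' : D), ← smul_add,
        add_sub_cancel]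
      rfl
    · rw [Algebra.algebraMap_eq_smul_one]
      apply Subtype.ext
      have h2 : (((f * f') • (1 : S) : S) : Matrix ι ι D[X]) = C ((f * f' : 𝒟 0) : D) • 1 :=
        (hscal _ _ hone).symm
      rw [h2]
      change (((f' • w : S) : Matrix ι ι D[X]) + ((f • w' : S) : Matrix ι ι D[X])) * (u + u') = _
      rw [hw, hw', mul_add, add_mul, add_mul, Matrix.smul_mul, Matrix.smul_mul,
        Matrix.smul_mul, Matrix.smul_mul, hvu, hvu', hvu0, hvu0', smul_zero, smul_zero, add_zero,
        zero_add, smul_smul, smul_smul, ← map_mul, ← map_mul, mul_comm (f' : D), ← smul_add,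
        add_sub_cancel]
      rfl
    · apply Subtype.ext
      change e * (u + u') = (u + u') * (φ 0 e' : S)
      have h3 : e * u' = 0 := by
        rw [← heu', ← mul_assoc, mul_sub, mul_one, he, sub_self, zero_mul]
      have h4 : u' * e.constTerm = 0 := by
        rw [← hue', mul_assoc, sub_mul, one_mul, he0, sub_self, mul_zero]
      rw [h0, mul_add, add_mul, heu, hue, h3, h4]

end

end

section

open Matrix Polynomial
open scoped LaurentPolynomial

section

variable {R Λ P : Type*} [CommRing R] [AddCommMonoid Λ] [AddCommGroup P]

theorem AddMonoidAlgebra.mem_gradeBy_iff_coeff {R Λ P : Type*} [CommRing R] {deg : Λ → P} {p : P} {f : AddMonoidAlgebra R Λ} :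
    f ∈ AddMonoidAlgebra.gradeBy R deg p ↔ ∀ s, f.coeff s ≠ 0 → deg s = p := by
  rw [AddMonoidAlgebra.mem_gradeBy_iff]
  exact ⟨fun h s hs => h (Finsupp.mem_support_iff.2 hs), fun h s hs =>
    h s (Finsupp.mem_support_iff.1 hs)⟩

theorem AddMonoidAlgebra.coeff_curryRingEquiv {N : Type*} [AddMonoid N]
    (f : AddMonoidAlgebra R (N × Λ)) (k : N) (s : Λ) :
    ((AddMonoidAlgebra.curryRingEquiv f).coeff k).coeff s = f.coeff (k, s) := by
  classical
  induction f using AddMonoidAlgebra.induction_linear with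
  | zero => simp
  | add f g hf hg => rw [map_add]; simp [hf, hg]
  | single m r =>
    obtain ⟨m, t⟩ := m
    rw [AddMonoidAlgebra.curryRingEquiv_single, AddMonoidAlgebra.coeff_single,
      AddMonoidAlgebra.coeff_single, Finsupp.single_apply, Finsupp.single_apply]
    by_cases h : m = k
    · simp [h, Finsupp.single_apply]
    · simp [h]

/-- A splitting, homogeneous for the grading `𝒜`, of the idempotent matrix `e` through a matrix
with entries in the base ring. -/
structure IsGradedSplitting {A ι σ : Type*} [CommRing A] [Algebra R A] [Fintype ι] [Fintype σ]
    (𝒜 : P → Submodule R A) (d : ι → P) (e : Matrix ι ι A) (δ : σ → P) (V : Matrix ι σ A)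
    (W : Matrix σ ι A) (c : Matrix σ σ R) : Prop where
  graded_left : IsGradedMatrix 𝒜 d δ V
  graded_right : IsGradedMatrix 𝒜 δ d W
  mul_eq : V * W = e
  mul_eq_map : W * V = c.map (algebraMap R A)

/-- The degree map on `N × Λ`, where the generator of `N` has degree `l`. -/
def natProdDeg (deg : Λ →+ P) (l : P) : ℕ × Λ →+ P := (multiplesHom P l).coprod deg

/-- The degree map on `ℤ × Λ`, where the generator of `ℤ` has degree `l`. -/
def intProdDeg (deg : Λ →+ P) (l : P) : ℤ × Λ →+ P := (zmultiplesHom P l).coprod deg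

/-- The identification of `R[ℕ × Λ]` with the polynomials over `R[Λ]`. -/
noncomputable def natProdEquiv (R Λ : Type*) [CommRing R] [AddCommMonoid Λ] :
    AddMonoidAlgebra R (ℕ × Λ) ≃+* (AddMonoidAlgebra R Λ)[X] :=
  AddMonoidAlgebra.curryRingEquiv.trans (toFinsuppIso _).symm

theorem coeff_natProdEquiv (f : AddMonoidAlgebra R (ℕ × Λ)) (k : ℕ) (s : Λ) :
    ((natProdEquiv R Λ f).coeff k).coeff s = f.coeff (k, s) :=
  AddMonoidAlgebra.coeff_curryRingEquiv f k s

theorem natProdEquiv_algebraMap (r : R) :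
    natProdEquiv R Λ (algebraMap R _ r) = C (algebraMap R _ r) := by
  change (toFinsuppIso _).symm (AddMonoidAlgebra.curryRingEquiv
    (AddMonoidAlgebra.single ((0, 0) : ℕ × Λ) r)) = _
  rw [AddMonoidAlgebra.curryRingEquiv_single]
  rfl

theorem natProdEquiv_mem {deg : Λ →+ P} {l p : P} {f : AddMonoidAlgebra R (ℕ × Λ)} :
    natProdEquiv R Λ f ∈ polynomialGrading (AddMonoidAlgebra.gradeBy R deg) l p ↔
      f ∈ AddMonoidAlgebra.gradeBy R (natProdDeg deg l) p := by
  simp only [mem_polynomialGrading, AddMonoidAlgebra.mem_gradeBy_iff_coeff, coeff_natProdEquiv,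
    Prod.forall]
  refine forall_congr' fun k => forall_congr' fun s => imp_congr_right fun _ => ?_
  rw [eq_sub_iff_add_eq, add_comm]
  rfl

theorem Matrix.map_natProdEquiv_map_symm {κ τ : Type*}
    (M : Matrix κ τ (AddMonoidAlgebra R (ℕ × Λ))) :
    (M.map (natProdEquiv R Λ)).map (natProdEquiv R Λ).symm = M := by
  ext1 i j
  exact (natProdEquiv R Λ).symm_apply_apply _

theorem IsGradedMatrix.map_natProdEquiv_symm {κ τ : Type*} {deg : Λ →+ P} {l : P} {d : κ → P}
    {d' : τ → P} {M : Matrix κ τ (AddMonoidAlgebra R Λ)[X]}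
    (hM : IsGradedMatrix (polynomialGrading (AddMonoidAlgebra.gradeBy R deg) l) d d' M) :
    IsGradedMatrix (AddMonoidAlgebra.gradeBy R (natProdDeg deg l)) d d'
      (M.map (natProdEquiv R Λ).symm) := fun i j => by
  rw [← natProdEquiv_mem, Matrix.map_apply, RingEquiv.apply_symm_apply]
  exact hM i j

theorem IsGradedMatrix.map_C {D κ τ : Type*} [CommRing D] [Algebra R D] {𝒟 : P → Submodule R D}
    {l : P} {d : κ → P} {d' : τ → P} {M : Matrix κ τ D} (hM : IsGradedMatrix 𝒟 d d' M) :
    IsGradedMatrix (polynomialGrading 𝒟 l) d d' (M.map C) :=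
  fun i j => C_mem_polynomialGrading (hM i j)

theorem curryRingEquiv_mem {deg : Λ →+ P} {l p : P} {f : AddMonoidAlgebra R (ℤ × Λ)} :
    AddMonoidAlgebra.curryRingEquiv f ∈ laurentGrading (AddMonoidAlgebra.gradeBy R deg) l p ↔
      f ∈ AddMonoidAlgebra.gradeBy R (intProdDeg deg l) p := by
  change (∀ k : ℤ, _) ↔ _
  simp only [AddMonoidAlgebra.mem_gradeBy_iff_coeff, AddMonoidAlgebra.coeff_curryRingEquiv,
    Prod.forall]
  refine forall_congr' fun k => forall_congr' fun s => imp_congr_right fun _ => ?_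
  rw [eq_sub_iff_add_eq, add_comm]
  rfl

variable [DecidableEq P] {ι : Type*} [Fintype ι] [DecidableEq ι]

/-- The matrix `e` over `R[Λ]` has a graded splitting through a matrix of the class `K`. -/
def HasGradedSplitting (K : ∀ s : ℕ, Set (Matrix (Fin s) (Fin s) R)) (deg : Λ → P) (d : ι → P)
    (e : Matrix ι ι (AddMonoidAlgebra R Λ)) : Prop :=
  ∃ (s : ℕ) (δ : Fin s → P) (V : Matrix ι (Fin s) (AddMonoidAlgebra R Λ))
    (W : Matrix (Fin s) ι (AddMonoidAlgebra R Λ)) (c : Matrix (Fin s) (Fin s) R),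
    c ∈ K s ∧ IsGradedSplitting (AddMonoidAlgebra.gradeBy R deg) d e δ V W c

theorem HasGradedSplitting.natProd [IsDomain (AddMonoidAlgebra R Λ)]
    {K : ∀ s : ℕ, Set (Matrix (Fin s) (Fin s) R)} {deg : Λ →+ P} {l : P} {d : ι → P}
    (H : ∀ n : Ideal R, n.IsMaximal → ∀ e : Matrix ι ι (AddMonoidAlgebra R (ℤ × Λ)), e * e = e →
      IsGradedMatrix (AddMonoidAlgebra.gradeBy R (intProdDeg deg l)) d d e →
      ∃ (s : ℕ) (δ : Fin s → P) (V : Matrix ι (Fin s) (AddMonoidAlgebra R (ℤ × Λ)))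
        (W : Matrix (Fin s) ι (AddMonoidAlgebra R (ℤ × Λ))) (f : R), f ∉ n ∧
        IsGradedFactorization (AddMonoidAlgebra.gradeBy R (intProdDeg deg l)) d e δ V W
          (algebraMap R _ f))
    (H₀ : ∀ e : Matrix ι ι (AddMonoidAlgebra R Λ), e * e = e →
      IsGradedMatrix (AddMonoidAlgebra.gradeBy R deg) d d e → HasGradedSplitting K deg d e)
    {e : Matrix ι ι (AddMonoidAlgebra R (ℕ × Λ))} (he : e * e = e)
    (hgr : IsGradedMatrix (AddMonoidAlgebra.gradeBy R (natProdDeg deg l)) d d e) :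
    HasGradedSplitting K (natProdDeg deg l) d e := by
  let 𝒟 := AddMonoidAlgebra.gradeBy R deg
  let Φ := natProdEquiv R Λ
  let Ψ : AddMonoidAlgebra R (ℤ × Λ) ≃+* (AddMonoidAlgebra R Λ)[T;T⁻¹] :=
    AddMonoidAlgebra.curryRingEquiv
  suffices hS : ∃ u v : Matrix ι ι (AddMonoidAlgebra R Λ)[X],
      IsGradedMatrix (polynomialGrading 𝒟 l) d d u ∧ IsGradedMatrix (polynomialGrading 𝒟 l) d d v ∧
      u * v = 1 ∧ v * u = 1 ∧ e.map Φ * u = u * (e.map Φ).constTerm by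
    obtain ⟨u, v, hu, hv, huv, hvu, heu⟩ := hS
    let e₀ : Matrix ι ι (AddMonoidAlgebra R Λ) := (e.map Φ).map constantCoeff
    obtain ⟨s, δ, V, W, c, hc, h⟩ := H₀ e₀ (by rw [← Matrix.map_mul, ← Matrix.map_mul, he])
      fun i j => by
        have := natProdEquiv_mem.2 (hgr i j) 0
        rwa [zero_smul, sub_zero] at this
    refine ⟨s, δ, (u * V.map C).map Φ.symm, (W.map C * v).map Φ.symm, c, hc,
      (hu.mul h.graded_left.map_C).map_natProdEquiv_symm,
      (h.graded_right.map_C.mul hv).map_natProdEquiv_symm, ?_, ?_⟩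
    · have h1 : (e.map Φ).constTerm = V.map C * W.map C := by
        rw [← Matrix.map_mul, h.mul_eq]
        rfl
      rw [← Matrix.map_mul, Matrix.mul_assoc, ← Matrix.mul_assoc (V.map C), ← h1,
        ← Matrix.mul_assoc, ← heu, Matrix.mul_assoc, huv, Matrix.mul_one, map_natProdEquiv_map_symm]
    · have h1 : W.map C * V.map C = (c.map (algebraMap R _)).map Φ := by
        rw [← Matrix.map_mul, h.mul_eq_map]
        ext1 i j
        exact (natProdEquiv_algebraMap _).symm
      rw [← Matrix.map_mul, Matrix.mul_assoc, ← Matrix.mul_assoc v, hvu, Matrix.one_mul, h1, map_natProdEquiv_map_symm]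
  refine exists_conj_constTerm ?_ (by rw [← Matrix.map_mul, he])
    fun i j => natProdEquiv_mem.2 (hgr i j)
  · intro m hm E hE hEgr
    let _ := hm
    obtain ⟨n, hn, hmn⟩ := Ideal.exists_le_maximal (m.comap (algebraMap R (𝒟 0)))
      (Ideal.comap_ne_top _ hm.ne_top)
    obtain ⟨s, δ, V, W, f, hf, h⟩ := H n hn (E.map Ψ.symm) (by rw [← Matrix.map_mul, hE])
      fun i j => by
        rw [← curryRingEquiv_mem]
        change Ψ (Ψ.symm _) ∈ _
        rw [Ψ.apply_symm_apply]
        exact hEgr i j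
    have hEE : (E.map Ψ.symm).map Ψ = E := by
      ext1 i j
      exact Ψ.apply_symm_apply _
    have hf' : Ψ (algebraMap R _ f) = LaurentPolynomial.C (algebraMap R _ f) := by
      change AddMonoidAlgebra.curryRingEquiv (AddMonoidAlgebra.single ((0, 0) : ℤ × Λ) f) = _
      rw [AddMonoidAlgebra.curryRingEquiv_single]
      rfl
    refine ⟨s, δ, V.map Ψ, W.map Ψ, algebraMap R (𝒟 0) f, fun hfm => hf (hmn hfm),
      fun i j => curryRingEquiv_mem.2 (h.graded_left i j),
      fun i j => curryRingEquiv_mem.2 (h.graded_right i j), ?_, ?_⟩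
    · rw [← Matrix.map_mul, h.mul_eq, Matrix.map_smul' _ _ _ (map_mul Ψ), hEE, hf']
      rfl
    · rw [← Matrix.map_mul, h.mul_eq_one, Matrix.map_smul' _ _ _ (map_mul Ψ), hf',
        Matrix.map_one _ (map_zero Ψ) (map_one Ψ)]
      rfl

end

end

section

section

open Matrix

variable {R Λ P : Type*} [CommRing R] [AddCommMonoid Λ] [AddCommGroup P]

/-- Every homogeneous idempotent matrix over `R[Λ]` has a graded splitting through a matrix of the
class `K`. -/
def GradedIdempotentsSplit (K : ∀ s : ℕ, Set (Matrix (Fin s) (Fin s) R)) (deg : Λ → P) : Prop :=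
  ∀ (r : ℕ) (d : Fin r → P) (e : Matrix (Fin r) (Fin r) (AddMonoidAlgebra R Λ)), e * e = e →
    IsGradedMatrix (AddMonoidAlgebra.gradeBy R deg) d d e → HasGradedSplitting K deg d e

theorem GradedIdempotentsSplit.of_addEquiv {Λ' : Type*} [AddCommMonoid Λ']
    {K : ∀ s : ℕ, Set (Matrix (Fin s) (Fin s) R)} {deg : Λ' →+ P} (φ : Λ ≃+ Λ')
    (h : GradedIdempotentsSplit K (deg.comp (φ : Λ →+ Λ'))) : GradedIdempotentsSplit K deg := by
  intro r d e he hgr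
  let Φ := AddMonoidAlgebra.domCongr R R φ
  have hΦ : ∀ {p : P} {f : AddMonoidAlgebra R Λ},
      f ∈ AddMonoidAlgebra.gradeBy R (deg.comp (φ : Λ →+ Λ')) p ↔
      Φ f ∈ AddMonoidAlgebra.gradeBy R deg p := fun {p f} => by
    rw [AddMonoidAlgebra.mem_gradeBy_iff_coeff, AddMonoidAlgebra.mem_gradeBy_iff_coeff]
    refine ⟨fun hf s hs => ?_, fun hf s hs => hf (φ s) ?_⟩
    · rw [AddMonoidAlgebra.coeff_domCongr] at hs
      have := hf _ hs
      rwa [AddMonoidHom.comp_apply, AddMonoidHom.coe_coe, AddEquiv.apply_symm_apply] at this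
    · rwa [AddMonoidAlgebra.coeff_domCongr, AddEquiv.symm_apply_apply]
  obtain ⟨s, δ, V, W, c, hc, hs⟩ := h r d (e.map Φ.symm) (by rw [← Matrix.map_mul, he])
    fun i j => by
      rw [hΦ, Matrix.map_apply, AlgEquiv.apply_symm_apply]
      exact hgr i j
  refine ⟨s, δ, V.map Φ, W.map Φ, c, hc, fun i j => hΦ.1 (hs.graded_left i j),
    fun i j => hΦ.1 (hs.graded_right i j), ?_, ?_⟩
  · rw [← Matrix.map_mul, hs.mul_eq]
    ext1 i j
    exact Φ.apply_symm_apply _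
  · rw [← Matrix.map_mul, hs.mul_eq_map]
    ext1 i j
    exact Φ.commutes _

theorem exists_natProdDeg (deg : ℕ × Λ →+ P) :
    deg = natProdDeg (deg.comp (AddMonoidHom.inr ℕ Λ)) (deg (1, 0)) := by
  ext ⟨k, s⟩
  change deg (k, s) = k • deg (1, 0) + deg (0, s)
  rw [← map_nsmul, ← map_add]
  simp

theorem HasGradedSplitting.exists_isGradedFactorization {ι : Type*} [Fintype ι] {deg : Λ → P}
    {d : ι → P} {e : Matrix ι ι (AddMonoidAlgebra R Λ)}
    (h : HasGradedSplitting (fun _ => {1}) deg d e) :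
    ∃ (s : ℕ) (δ : Fin s → P) (V : Matrix ι (Fin s) (AddMonoidAlgebra R Λ))
      (W : Matrix (Fin s) ι (AddMonoidAlgebra R Λ)),
      IsGradedFactorization (AddMonoidAlgebra.gradeBy R deg) d e δ V W 1 := by
  obtain ⟨s, δ, V, W, c, rfl, h⟩ := h
  refine ⟨s, δ, V, W, h.graded_left, h.graded_right, ?_, ?_⟩
  · rw [h.mul_eq, one_smul]
  · rw [h.mul_eq_map, one_smul, Matrix.map_one _ (map_zero _) (map_one _)]

/-- Adding one variable in the domain of the tuples. -/
def consAddEquiv (N : Type*) [AddCommMonoid N] (n : ℕ) : N × (Fin n → N) ≃+ (Fin (n + 1) → N) :=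
  (Fin.consLinearEquiv ℕ fun _ => N).toAddEquiv

theorem GradedIdempotentsSplit.pi_nat_prod_pi_int [DecidableEq P] [IsDomain R]
    (h : ∀ (b : ℕ) (deg : (Fin b → ℤ) →+ P),
      GradedIdempotentsSplit (R := R) (fun _ => {1}) deg) (a b : ℕ)
    (deg : (Fin a → ℕ) × (Fin b → ℤ) →+ P) :
    GradedIdempotentsSplit (R := R) (fun _ => {1}) deg := by
  induction a generalizing b with
  | zero => exact .of_addEquiv AddEquiv.uniqueProd.symm (h b _)
  | succ a ih =>
    refine .of_addEquiv (AddEquiv.prodAssoc.symm.trans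
      ((consAddEquiv ℕ a).prodCongr (AddEquiv.refl (Fin b → ℤ)))) ?_
    rw [exists_natProdDeg (AddMonoidHom.comp _ _)]
    intro r d e he hgr
    refine HasGradedSplitting.natProd (fun n hn E hE hEgr => ?_) (fun e he hgr => ih b _ r d e he hgr)
      he hgr
    have h1 := GradedIdempotentsSplit.of_addEquiv
      (((AddEquiv.prodAssoc.symm.trans (AddEquiv.prodComm.prodCongr (AddEquiv.refl _))).trans
        AddEquiv.prodAssoc).trans
          ((AddEquiv.refl (Fin a → ℕ)).prodCongr (consAddEquiv ℤ b))).symm (ih (b + 1) _) r d E hE hEgr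
    obtain ⟨s, δ, V, W, hVW⟩ := h1.exists_isGradedFactorization
    refine ⟨s, δ, V, W, 1, fun h => hn.ne_top ((Ideal.eq_top_iff_one _).2 h), ?_⟩
    rwa [map_one]

theorem exists_map_eq_smul (N : Submonoid R) (S : Type*) [CommRing S] [Algebra R S]
    [IsLocalization N S] (hinj : Function.Injective (algebraMap R S)) {κ τ : Type*} [Fintype κ]
    [Fintype τ] (V : Matrix κ τ (AddMonoidAlgebra S Λ)) :
    ∃ f ∈ N, ∃ V' : Matrix κ τ (AddMonoidAlgebra R Λ),
      V'.map (AddMonoidAlgebra.mapRingHom Λ (algebraMap R S)) =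
        algebraMap S (AddMonoidAlgebra S Λ) (algebraMap R S f) • V := by
  classical
  obtain ⟨f, hf⟩ := IsLocalization.exist_integer_multiples_of_finset N
    (Finset.univ.biUnion fun ij : κ × τ =>
      (V ij.1 ij.2).coeff.support.image (V ij.1 ij.2).coeff)
  let q : S → R := fun a => if h : ∃ r, algebraMap R S r = (f : R) • a then h.choose else 0
  have hq : ∀ a, (∃ r, algebraMap R S r = (f : R) • a) → algebraMap R S (q a) = (f : R) • a :=
    fun a ha => by
      simp only [q, dif_pos ha]
      exact ha.choose_spec
  have hq0 : q 0 = 0 := hinj (by rw [hq 0 ⟨0, by simp⟩, smul_zero, map_zero])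
  refine ⟨f, f.2, Matrix.of fun i j => AddMonoidAlgebra.ofCoeff ((V i j).coeff.mapRange q hq0), ?_⟩
  ext i j s
  rw [Matrix.map_apply, Matrix.of_apply, AddMonoidAlgebra.coeff_mapRingHom,
    AddMonoidAlgebra.coeff_ofCoeff,
    Finsupp.mapRange_apply, Matrix.smul_apply, smul_eq_mul, ← Algebra.smul_def,
    AddMonoidAlgebra.coeff_smul_apply, smul_eq_mul, hq, Algebra.smul_def]
  by_cases hs : (V i j).coeff s = 0
  · exact ⟨0, by rw [hs, smul_zero, map_zero]⟩
  · exact hf _ (Finset.mem_biUnion.2 ⟨(i, j), Finset.mem_univ _, Finset.mem_image_of_mem _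
      (Finsupp.mem_support_iff.2 hs)⟩)

theorem exists_isGradedFactorization_of_localization (N : Submonoid R) (S : Type*) [CommRing S]
    [Algebra R S] [IsLocalization N S] (hinj : Function.Injective (algebraMap R S)) {deg : Λ →+ P}
    (h : GradedIdempotentsSplit (R := S) (fun _ => {1}) deg) {r : ℕ} {d : Fin r → P}
    {e : Matrix (Fin r) (Fin r) (AddMonoidAlgebra R Λ)} (he : e * e = e)
    (hgr : IsGradedMatrix (AddMonoidAlgebra.gradeBy R deg) d d e) :
    ∃ (s : ℕ) (δ : Fin s → P) (V : Matrix (Fin r) (Fin s) (AddMonoidAlgebra R Λ))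
      (W : Matrix (Fin s) (Fin r) (AddMonoidAlgebra R Λ)) (f : R), f ∈ N ∧
      IsGradedFactorization (AddMonoidAlgebra.gradeBy R deg) d e δ V W (algebraMap R _ f) := by
  let ρ := AddMonoidAlgebra.mapRingHom Λ (algebraMap R S)
  have hρ : Function.Injective ρ := fun x y hxy => by
    ext s
    apply hinj
    rw [← AddMonoidAlgebra.coeff_mapRingHom, ← AddMonoidAlgebra.coeff_mapRingHom]
    exact congrArg (fun z => z.coeff s) hxy
  have hρgr : ∀ {p : P} {f : AddMonoidAlgebra R Λ}, ρ f ∈ AddMonoidAlgebra.gradeBy S deg p ↔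
      f ∈ AddMonoidAlgebra.gradeBy R deg p := fun {p f} => by
    rw [AddMonoidAlgebra.mem_gradeBy_iff_coeff, AddMonoidAlgebra.mem_gradeBy_iff_coeff]
    refine forall_congr' fun s => imp_congr_left ?_
    rw [AddMonoidAlgebra.coeff_mapRingHom, map_ne_zero_iff _ hinj]
  have hρa : ∀ f : R, ρ (algebraMap R _ f) = algebraMap S _ (algebraMap R S f) := fun f =>
    AddMonoidAlgebra.mapRingHom_single _ _ _
  obtain ⟨s, δ, V, W, hVW⟩ := (h r d (e.map ρ) (by rw [← Matrix.map_mul, he])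
    fun i j => hρgr.2 (hgr i j)).exists_isGradedFactorization
  obtain ⟨f, hf, V', hV'⟩ := exists_map_eq_smul N S hinj V
  obtain ⟨g, hg, W', hW'⟩ := exists_map_eq_smul N S hinj W
  have hmap : ∀ {κ τ : Type} {M M' : Matrix κ τ (AddMonoidAlgebra R Λ)}, M.map ρ = M'.map ρ →
      M = M' := fun h => Matrix.map_injective hρ h
  refine ⟨s, δ, V', W', f * g, mul_mem hf hg, fun i j => hρgr.1 ?_, fun i j => hρgr.1 ?_,
    hmap ?_, hmap ?_⟩
  · rw [show ρ (V' i j) = _ from congrFun (congrFun hV' i) j, Matrix.smul_apply, smul_eq_mul,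
      ← Algebra.smul_def]
    exact Submodule.smul_mem _ _ (hVW.graded_left i j)
  · rw [show ρ (W' i j) = _ from congrFun (congrFun hW' i) j, Matrix.smul_apply, smul_eq_mul,
      ← Algebra.smul_def]
    exact Submodule.smul_mem _ _ (hVW.graded_right i j)
  · rw [Matrix.map_mul, hV', hW', Matrix.smul_mul, Matrix.mul_smul, hVW.mul_eq, one_smul, smul_smul,
      Matrix.map_smul' _ _ _ (map_mul ρ), hρa, map_mul, map_mul]
  · rw [Matrix.map_mul, hV', hW', Matrix.smul_mul, Matrix.mul_smul, hVW.mul_eq_one, one_smul,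
      smul_smul, Matrix.map_smul' _ _ _ (map_mul ρ), hρa, map_mul, map_mul, mul_comm,
      Matrix.map_one _ (map_zero ρ) (map_one ρ)]

theorem algebraMap_coeff_zero_of_subsingleton [Subsingleton Λ] (x : AddMonoidAlgebra R Λ) :
    algebraMap R (AddMonoidAlgebra R Λ) (x.coeff 0) = x := by
  refine AddMonoidAlgebra.coeff_injective (Finsupp.ext fun s => ?_)
  rw [Subsingleton.elim s 0]
  exact (DFunLike.congr_fun (AddMonoidAlgebra.coeff_single 0 (x.coeff 0)) 0).trans
    Finsupp.single_eq_same

theorem GradedIdempotentsSplit.pi_nat [DecidableEq P] [IsDomain R]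
    (h : ∀ (m : Ideal R) (hm : m.IsMaximal) (b : ℕ) (deg : (Fin b → ℤ) →+ P),
      GradedIdempotentsSplit (R := @Localization.AtPrime R _ m hm.isPrime) (fun _ => {1}) deg)
    (a : ℕ) (deg : (Fin a → ℕ) →+ P) :
    GradedIdempotentsSplit (R := R) (fun _ => Set.univ) deg := by
  induction a with
  | zero =>
    intro r d e he hgr
    have hc : e = (e.map fun f => f.coeff 0).map (algebraMap R _) := by
      ext1 i j
      exact (algebraMap_coeff_zero_of_subsingleton _).symm
    refine ⟨r, d, e, e, e.map fun f => f.coeff 0, Set.mem_univ _, hgr, hgr, he, ?_⟩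
    rw [he, ← hc]
  | succ a ih =>
    refine .of_addEquiv (consAddEquiv ℕ a) ?_
    rw [exists_natProdDeg (AddMonoidHom.comp _ _)]
    intro r d e he hgr
    refine HasGradedSplitting.natProd (fun n hn E hE hEgr => ?_) (fun e he hgr => ih _ r d e he hgr)
      he hgr
    let _ := hn.isPrime
    exact exists_isGradedFactorization_of_localization n.primeCompl (Localization.AtPrime n)
      (IsLocalization.injective _ n.primeCompl_le_nonZeroDivisors)
      (.of_addEquiv (((AddEquiv.funUnique (Fin 1) ℤ).prodCongr (AddEquiv.refl (Fin a → ℕ))).symm.trans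
        AddEquiv.prodComm).symm (.pi_nat_prod_pi_int (h n hn) a 1 _)) hE hEgr

end

end

section

open Matrix

section

theorem Matrix.exists_mul_eq_one_of_allFGProjectiveFree {B : Type u} [CommRing B]
    (h : AllFGProjectiveFree B) {r : ℕ} (f : Matrix (Fin r) (Fin r) B) (hf : f * f = f) :
    ∃ (s : ℕ) (V : Matrix (Fin r) (Fin s) B) (W : Matrix (Fin s) (Fin r) B),
      V * W = f ∧ W * V = 1 := by
  cases subsingleton_or_nontrivial B
  · exact ⟨0, 0, 0, Subsingleton.elim _ _, Subsingleton.elim _ _⟩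
  let N := LinearMap.range (Matrix.toLin' f)
  have hp : (Matrix.toLin' f).rangeRestrict ∘ₗ N.subtype = LinearMap.id := by
    refine LinearMap.ext fun ⟨_, y, rfl⟩ => Subtype.ext ?_
    change (Matrix.toLin' f) (Matrix.toLin' f y) = Matrix.toLin' f y
    rw [← LinearMap.comp_apply, ← Matrix.toLin'_mul, hf]
  have : Module.Projective B N := Module.Projective.of_split _ _ hp
  have : Module.Free B N := h N inferInstance this
  let b := Module.finBasis B N
  refine ⟨_, LinearMap.toMatrix' (N.subtype ∘ₗ b.equivFun.symm.toLinearMap),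
    LinearMap.toMatrix' (b.equivFun.toLinearMap ∘ₗ (Matrix.toLin' f).rangeRestrict), ?_, ?_⟩
  · rw [← LinearMap.toMatrix'_comp]
    refine (congrArg LinearMap.toMatrix' (LinearMap.ext fun x => ?_)).trans
      (LinearMap.toMatrix'_toLin' f)
    simp
  · rw [← LinearMap.toMatrix'_comp, ← LinearMap.toMatrix'_id]
    refine congrArg LinearMap.toMatrix' (LinearMap.ext fun x => ?_)
    have := LinearMap.congr_fun hp (b.equivFun.symm x)
    simp only [LinearMap.comp_apply, LinearMap.id_apply, LinearEquiv.coe_coe] at this ⊢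
    rw [this, LinearEquiv.apply_symm_apply]

variable {S : Type u} [CommRing S] {P : Type*} [AddCommGroup P]

theorem CondDaggerDagger.allFGProjectiveFree (h : CondDaggerDagger S) (k : ℕ) :
    AllFGProjectiveFree (AddMonoidAlgebra S (PUnit.{u + 1} × (Fin k → ℤ))) := by
  intro M _ _ hM hM'
  obtain ⟨F, _, _, hF, hF', ⟨e⟩⟩ := h.2 k PUnit.{u + 1} (fun _ _ _ _ => rfl)
    (fun _ _ _ _ _ => rfl) (fun _ _ _ _ => ⟨0, rfl⟩) (fun _ _ _ => rfl) M hM hM'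
  have := h.1 F hF'
  exact Module.Free.of_equiv e.symm

theorem exists_injective_range_eq_ker {b : ℕ} (deg : (Fin b → ℤ) →+ P) :
    ∃ (k : ℕ) (ψ : PUnit.{u + 1} × (Fin k → ℤ) →+ (Fin b → ℤ)), Function.Injective ψ ∧
      ∀ x, deg x = 0 ↔ x ∈ Set.range ψ := by
  let H := LinearMap.ker deg.toIntLinearMap
  let β := Module.finBasis ℤ H
  let χ : PUnit.{u + 1} × (Fin (Module.finrank ℤ H) → ℤ) ≃+ H :=
    AddEquiv.uniqueProd.trans β.equivFun.symm.toAddEquiv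
  refine ⟨_, H.subtype.toAddMonoidHom.comp χ.toAddMonoidHom,
    Subtype.val_injective.comp χ.injective, fun x => ⟨fun hx => ⟨χ.symm ⟨x, hx⟩, ?_⟩, ?_⟩⟩
  · exact congrArg Subtype.val (χ.apply_symm_apply ⟨x, hx⟩)
  · rintro ⟨y, rfl⟩
    exact (χ y).2

theorem CondDaggerDagger.exists_mul_eq_one (h : CondDaggerDagger S) {b : ℕ}
    (deg : (Fin b → ℤ) →+ P) {r : ℕ} {f : Matrix (Fin r) (Fin r) (AddMonoidAlgebra S (Fin b → ℤ))}
    (hf : f * f = f) (hgr : ∀ i j, f i j ∈ AddMonoidAlgebra.gradeBy S deg 0) :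
    ∃ (s : ℕ) (V : Matrix (Fin r) (Fin s) (AddMonoidAlgebra S (Fin b → ℤ)))
      (W : Matrix (Fin s) (Fin r) (AddMonoidAlgebra S (Fin b → ℤ))),
      V * W = f ∧ W * V = 1 ∧ (∀ i j, V i j ∈ AddMonoidAlgebra.gradeBy S deg 0) ∧
        ∀ i j, W i j ∈ AddMonoidAlgebra.gradeBy S deg 0 := by
  obtain ⟨k, ψ, hψ, hker⟩ := exists_injective_range_eq_ker deg
  let j := AddMonoidAlgebra.mapDomainRingHom S ψ
  have hj : Function.Injective j := AddMonoidAlgebra.mapDomain_injective hψ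
  have hjgr : ∀ x, j x ∈ AddMonoidAlgebra.gradeBy S deg 0 := fun x => by
    rw [AddMonoidAlgebra.mem_gradeBy_iff_coeff]
    intro s hs
    rw [hker]
    by_contra hs'
    refine hs ?_
    rw [show j x = AddMonoidAlgebra.mapDomain ψ x from rfl, AddMonoidAlgebra.coeff_mapDomain]
    exact Finsupp.mapDomain_of_notMem_range _ _ hs'
  have hlift : ∀ i k, ∃ y, j y = f i k := fun i k =>
    ⟨_, AddMonoidAlgebra.mapDomain_comapDomain (fun s hs => (hker s).1
      (AddMonoidAlgebra.mem_gradeBy_iff_coeff.1 (hgr i k) s (Finsupp.mem_support_iff.1 hs))) hψ⟩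
  choose g hg using hlift
  have hgf : (Matrix.of g).map j = f := by
    ext1 i k
    exact hg i k
  obtain ⟨s, V, W, hVW, hWV⟩ := Matrix.exists_mul_eq_one_of_allFGProjectiveFree
    (h.allFGProjectiveFree k) (Matrix.of g) (Matrix.map_injective hj (by
      beta_reduce
      rw [Matrix.map_mul, hgf, hf]))
  exact ⟨s, V.map j, W.map j, by rw [← Matrix.map_mul, hVW, hgf],
    by rw [← Matrix.map_mul, hWV, Matrix.map_one _ (map_zero j) (map_one j)],
    fun _ _ => hjgr _, fun _ _ => hjgr _⟩

theorem exists_representative_index {Λ : Type*} [AddCommGroup Λ] (deg : Λ →+ P) {ι : Type*}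
    (d : ι → P) : ∃ (c : ι → ι) (t : ι → Λ), (∀ i, deg (t i) = d i - d (c i)) ∧
      ∀ i j x, deg x = d i - d j → c i = c j := by
  let κ : ι → P ⧸ deg.range := fun i => (d i : P ⧸ deg.range)
  let c : ι → ι := fun i => (Quotient.mk (Setoid.ker κ) i).out
  have hc : ∀ i, κ (c i) = κ i := fun i => Quotient.mk_out (s := Setoid.ker κ) i
  have hex : ∀ i, ∃ x, deg x = d i - d (c i) := fun i => by
    have := QuotientAddGroup.eq.1 (hc i)
    rwa [neg_add_eq_sub] at this
  choose t ht using hex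
  refine ⟨c, t, ht, fun i j x hx => congrArg Quotient.out (Quotient.sound ?_)⟩
  refine Eq.symm (QuotientAddGroup.eq.2 ?_)
  rw [neg_add_eq_sub]
  exact ⟨x, hx⟩

theorem IsGradedSplitting.hasGradedSplitting {Λ ι σ : Type*} [AddCommMonoid Λ] [Fintype ι]
    [Fintype σ] [DecidableEq σ] {deg : Λ → P} {d : ι → P} {e : Matrix ι ι (AddMonoidAlgebra S Λ)}
    {δ : σ → P} {V : Matrix ι σ (AddMonoidAlgebra S Λ)} {W : Matrix σ ι (AddMonoidAlgebra S Λ)}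
    (h : IsGradedSplitting (AddMonoidAlgebra.gradeBy S deg) d e δ V W (1 : Matrix σ σ S)) :
    HasGradedSplitting (R := S) (fun _ => {1}) deg d e := by
  let ε := (Fintype.equivFin σ).symm
  refine ⟨_, δ ∘ ε, V.submatrix id ε, W.submatrix ε id, 1, rfl, fun i j => h.graded_left i _,
    fun i j => h.graded_right _ j, ?_, ?_⟩
  · rw [Matrix.submatrix_mul_equiv, h.mul_eq, Matrix.submatrix_id_id]
  · rw [← Matrix.submatrix_mul _ _ _ _ _ Function.bijective_id, h.mul_eq_map,
      Matrix.map_one _ (map_zero _) (map_one _), Matrix.map_one _ (map_zero _) (map_one _),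
      Matrix.submatrix_one_equiv]

/-- If the blocks of the idempotent matrix `F` cut out by `c` split, then `F` splits. -/
theorem Matrix.exists_sigma_splitting {B ι : Type*} [CommRing B] [Fintype ι] [DecidableEq ι]
    [Algebra S B] {K : Submodule S B} {c : ι → ι} {F : Matrix ι ι B} (hF : F * F = F) (hc : ∀ i j, c i ≠ c j → F i j = 0)
    (hK : ∀ i j, F i j ∈ K)
    (h : ∀ f : Matrix ι ι B, f * f = f → (∀ i j, f i j ∈ K) → ∃ (s : ℕ) (V : Matrix ι (Fin s) B)
      (W : Matrix (Fin s) ι B), V * W = f ∧ W * V = 1 ∧ (∀ i j, V i j ∈ K) ∧ ∀ i j, W i j ∈ K) :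
    ∃ (s : ι → ℕ) (V : Matrix ι (Σ q, Fin (s q)) B) (W : Matrix (Σ q, Fin (s q)) ι B),
      V * W = F ∧ W * V = 1 ∧ (∀ i j, V i j ∈ K) ∧ (∀ i j, W i j ∈ K) ∧
      (∀ i j, c i ≠ j.1 → V i j = 0) ∧ ∀ i j, c j ≠ i.1 → W i j = 0 := by
  let Q : ι → Matrix ι ι B := fun q => Matrix.diagonal fun i => if c i = q then 1 else 0
  have hQF : ∀ q, Q q * F = F * Q q := fun q => by
    ext1 i j
    rw [Matrix.diagonal_mul, Matrix.mul_diagonal]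
    by_cases hij : c i = c j
    · rw [hij, mul_comm]
    · rw [hc i j hij, mul_zero, zero_mul]
  have hQQ : ∀ q, Q q * Q q = Q q := fun q => by
    rw [Matrix.diagonal_mul_diagonal]
    refine congrArg _ (funext fun i => ?_)
    split_ifs <;> simp
  have hQQ' : ∀ q q', q ≠ q' → Q q * Q q' = 0 := fun q q' hq => by
    rw [Matrix.diagonal_mul_diagonal, ← Matrix.diagonal_zero]
    refine congrArg _ (funext fun i => ?_)
    by_cases hi : c i = q
    · rw [if_neg (hi ▸ hq : c i ≠ q'), mul_zero]
    · rw [if_neg hi, zero_mul]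
  have hff : ∀ q, (Q q * F) * (Q q * F) = Q q * F := fun q => by
    rw [Matrix.mul_assoc, ← Matrix.mul_assoc F, ← hQF, Matrix.mul_assoc (Q q) F, hF,
      ← Matrix.mul_assoc, hQQ]
  have hfK : ∀ q i j, (Q q * F) i j ∈ K := fun q i j => by
    rw [Matrix.diagonal_mul]
    split_ifs
    · rw [one_mul]
      exact hK i j
    · rw [zero_mul]
      exact K.zero_mem
  choose s V W hVW hWV hV hW using fun q => h (Q q * F) (hff q) (hfK q)
  have hVf : ∀ q, V q = Q q * (F * V q) := fun q => by
    rw [← Matrix.mul_assoc, ← hVW, Matrix.mul_assoc, hWV, Matrix.mul_one]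
  have hWf : ∀ q, W q = W q * F * Q q := fun q => by
    rw [Matrix.mul_assoc, ← hQF, ← hVW, ← Matrix.mul_assoc, hWV, Matrix.one_mul]
  refine ⟨s, Matrix.of fun i x => V x.1 i x.2, Matrix.of fun x j => W x.1 x.2 j, ?_, ?_,
    fun i j => hV _ _ _, fun i j => hW _ _ _, fun i j hij => ?_, fun i j hij => ?_⟩
  · ext1 i j
    rw [Matrix.mul_apply, Fintype.sum_sigma]
    calc _ = ∑ q, (V q * W q) i j := rfl
      _ = ∑ q, if c i = q then F i j else 0 := by
        refine Finset.sum_congr rfl fun q _ => ?_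
        rw [hVW, Matrix.diagonal_mul, ite_mul, one_mul, zero_mul]
      _ = F i j := by simp
  · ext1 ⟨q, k⟩ ⟨q', k'⟩
    rw [Matrix.mul_apply]
    change (W q * V q') k k' = _
    by_cases hq : q = q'
    · subst hq
      rw [hWV, Matrix.one_apply, Matrix.one_apply]
      simp
    · rw [hVf q', hWf q, Matrix.mul_assoc, ← Matrix.mul_assoc (Q q), hQQ' q q' hq, Matrix.zero_mul,
        Matrix.mul_zero, Matrix.one_apply_ne fun hh => hq (congrArg Sigma.fst hh)]
      rfl
  · rw [Matrix.of_apply, hVf, Matrix.diagonal_mul, if_neg hij, zero_mul]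
  · rw [Matrix.of_apply, hWf, Matrix.mul_diagonal, if_neg hij, mul_zero]

theorem IsGradedMatrix.diagonal {A ι : Type*} [CommRing A] [Algebra S A] [DecidableEq ι]
    {𝒜 : P → Submodule S A} {d d' : ι → P} {v : ι → A} (h : ∀ i, v i ∈ 𝒜 (d i - d' i)) :
    IsGradedMatrix 𝒜 d d' (Matrix.diagonal v) := fun i j => by
  by_cases hij : i = j
  · subst hij
    rw [Matrix.diagonal_apply_eq]
    exact h i
  · rw [Matrix.diagonal_apply_ne _ hij]
    exact Submodule.zero_mem _

theorem CondDaggerDagger.gradedIdempotentsSplit [DecidableEq P] (h : CondDaggerDagger S) (b : ℕ)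
    (deg : (Fin b → ℤ) →+ P) : GradedIdempotentsSplit (R := S) (fun _ => {1}) deg := by
  intro r d e he hgr
  obtain ⟨c, t, ht, hc⟩ := exists_representative_index deg d
  let u : (Fin b → ℤ) → AddMonoidAlgebra S (Fin b → ℤ) := fun x => AddMonoidAlgebra.single x 1
  have hu : ∀ x, u (-x) * u x = 1 := fun x => by
    rw [AddMonoidAlgebra.single_mul_single, neg_add_cancel, mul_one]
    rfl
  have hudeg : ∀ x p, deg x = p → u x ∈ AddMonoidAlgebra.gradeBy S deg p := fun x p hx =>
    hx ▸ AddMonoidAlgebra.single_mem_gradeBy _ _ _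
  let D : Matrix (Fin r) (Fin r) (AddMonoidAlgebra S (Fin b → ℤ)) := Matrix.diagonal fun i => u (t i)
  let D' : Matrix (Fin r) (Fin r) (AddMonoidAlgebra S (Fin b → ℤ)) :=
    Matrix.diagonal fun i => u (-t i)
  have hD : D' * D = 1 := by
    rw [Matrix.diagonal_mul_diagonal, ← Matrix.diagonal_one]
    exact congrArg _ (funext fun i => hu (t i))
  have hD' : D * D' = 1 := by
    rw [Matrix.diagonal_mul_diagonal, ← Matrix.diagonal_one]
    exact congrArg _ (funext fun i => (mul_comm _ _).trans (hu (t i)))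
  have hDgr : IsGradedMatrix (AddMonoidAlgebra.gradeBy S deg) d (d ∘ c) D :=
    .diagonal fun i => hudeg _ _ (ht i)
  have hDgr' : IsGradedMatrix (AddMonoidAlgebra.gradeBy S deg) (d ∘ c) d D' :=
    .diagonal fun i => hudeg _ _ (by rw [map_neg, ht, neg_sub]; rfl)
  have he0 : ∀ i j, c i ≠ c j → e i j = 0 := fun i j hij => by
    refine AddMonoidAlgebra.coeff_injective (Finsupp.ext fun x => ?_)
    by_contra hx
    exact hij (hc i j x (AddMonoidAlgebra.mem_gradeBy_iff_coeff.1 (hgr i j) x hx))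
  have hF0 : ∀ i j, c i ≠ c j → (D' * e * D) i j = 0 := fun i j hij => by
    rw [Matrix.mul_diagonal, Matrix.diagonal_mul, he0 i j hij, mul_zero, zero_mul]
  obtain ⟨s, V, W, hVW, hWV, hV, hW, hV0, hW0⟩ := Matrix.exists_sigma_splitting (S := S)
    (K := AddMonoidAlgebra.gradeBy S deg 0) (c := c) (F := D' * e * D)
    (by rw [Matrix.mul_assoc (D' * e), Matrix.mul_assoc D', ← Matrix.mul_assoc D,
      ← Matrix.mul_assoc D, hD', Matrix.one_mul, ← Matrix.mul_assoc e, he, ← Matrix.mul_assoc])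
    hF0 (fun i j => by
      by_cases hij : c i = c j
      · have := ((hDgr'.mul hgr).mul hDgr) i j
        rwa [Function.comp_apply, Function.comp_apply, hij, sub_self] at this
      · rw [hF0 i j hij]
        exact Submodule.zero_mem _)
    fun f hf hfK => h.exists_mul_eq_one deg hf hfK
  have hVgr : IsGradedMatrix (AddMonoidAlgebra.gradeBy S deg) (d ∘ c) (fun x => d x.1) V :=
    fun i j => by
      by_cases hij : c i = j.1
      · rw [Function.comp_apply, hij, sub_self]
        exact hV i j
      · rw [hV0 i j hij]
        exact Submodule.zero_mem _
  have hWgr : IsGradedMatrix (AddMonoidAlgebra.gradeBy S deg) (fun x => d x.1) (d ∘ c) W :=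
    fun i j => by
      by_cases hij : c j = i.1
      · rw [Function.comp_apply, hij, sub_self]
        exact hW i j
      · rw [hW0 i j hij]
        exact Submodule.zero_mem _
  refine IsGradedSplitting.hasGradedSplitting (σ := Σ q, Fin (s q)) (δ := fun x => d x.1)
    (V := D * V) (W := W * D') ⟨hDgr.mul hVgr, hWgr.mul hDgr', ?_, ?_⟩
  · rw [Matrix.mul_assoc, ← Matrix.mul_assoc V, hVW, Matrix.mul_assoc _ D, hD', Matrix.mul_one,
      ← Matrix.mul_assoc, hD', Matrix.one_mul]
  · rw [Matrix.mul_assoc, ← Matrix.mul_assoc D', hD, Matrix.one_mul, hWV,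
      Matrix.map_one _ (map_zero _) (map_one _)]

end

end

section

open Matrix
open scoped TensorProduct

section

variable {R A P M : Type*} [CommRing R] [CommRing A] [Algebra R A] [AddCommGroup P]
  [DecidableEq P] [AddCommGroup M] [Module R M] [Module A M]
  {𝒜 : P → Submodule R A} {ℳ : P → Submodule R M}

/-- A finite dual basis of the graded module `ℳ`, consisting of homogeneous elements `m i` of
degree `d i` and of forms `φ i` of degree `- d i`. -/
structure IsGradedDualBasis {ι : Type*} [Fintype ι] (𝒜 : P → Submodule R A)
    (ℳ : P → Submodule R M) (d : ι → P) (m : ι → M) (φ : ι → M →ₗ[A] A) : Prop where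
  mem : ∀ i, m i ∈ ℳ (d i)
  apply_mem : ∀ {p x} i, x ∈ ℳ p → φ i x ∈ 𝒜 (p - d i)
  sum_smul : ∀ x, ∑ i, φ i x • m i = x

theorem coe_decompose_smul_add_of_right_mem [GradedAlgebra 𝒜] [DirectSum.Decomposition ℳ]
    (hsmul : ∀ {a b : P} {x : A} {m : M}, x ∈ 𝒜 a → m ∈ ℳ b → x • m ∈ ℳ (a + b)) {p q : P}
    (a : A) {m : M} (hm : m ∈ ℳ q) :
    (DirectSum.decompose ℳ (a • m) (p + q) : M) = (DirectSum.decompose 𝒜 a p : A) • m := by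
  induction a using DirectSum.Decomposition.inductionOn 𝒜 with
  | zero => simp
  | @homogeneous i a =>
    by_cases hi : i = p
    · subst hi
      rw [DirectSum.decompose_of_mem_same _ (hsmul a.2 hm), DirectSum.decompose_of_mem_same _ a.2]
    · rw [DirectSum.decompose_of_mem_ne _ (hsmul a.2 hm) fun h => hi (add_right_cancel h),
        DirectSum.decompose_of_mem_ne _ a.2 hi, zero_smul]
  | add a b ha hb =>
    rw [add_smul, DirectSum.decompose_add, DirectSum.decompose_add, DirectSum.add_apply,
      DirectSum.add_apply, Submodule.coe_add, Submodule.coe_add, ha, hb, add_smul]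

/-- The homogeneous components of linear forms on a graded module. -/
theorem exists_linearMap_apply_eq_decompose [IsScalarTower R A M] [GradedAlgebra 𝒜]
    [DirectSum.Decomposition ℳ]
    (hsmul : ∀ {a b : P} {x : A} {m : M}, x ∈ 𝒜 a → m ∈ ℳ b → x • m ∈ ℳ (a + b))
    (g : M →ₗ[A] A) (q : P) :
    ∃ g' : M →ₗ[A] A, ∀ p, ∀ x ∈ ℳ p, g' x = (DirectSum.decompose 𝒜 (g x) (p + q) : A) := by
  let G : M →ₗ[R] A := (DirectSum.toModule R P A fun p =>
    GradedAlgebra.proj 𝒜 (p + q) ∘ₗ g.restrictScalars R ∘ₗ (ℳ p).subtype) ∘ₗ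
      (DirectSum.decomposeLinearEquiv ℳ).toLinearMap
  have hG : ∀ p, ∀ x ∈ ℳ p, G x = (DirectSum.decompose 𝒜 (g x) (p + q) : A) := fun p x hx => by
    change DirectSum.toModule R P A _ (DirectSum.decompose ℳ x) = _
    rw [DirectSum.decompose_of_mem _ hx]
    exact DirectSum.toModule_lof R p _
  refine ⟨{ G with map_smul' := fun a x => ?_ }, hG⟩
  change G (a • x) = a • G x
  induction x using DirectSum.Decomposition.inductionOn ℳ with
  | zero => simp
  | add x y hx hy => rw [smul_add, map_add, map_add, hx, hy, smul_add]
  | @homogeneous p x =>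
    induction a using DirectSum.Decomposition.inductionOn 𝒜 with
    | zero => simp
    | add a b ha hb => rw [add_smul, map_add, ha, hb, add_smul]
    | @homogeneous i a =>
      rw [hG _ _ (hsmul a.2 x.2), hG _ _ x.2, map_smul, smul_eq_mul, smul_eq_mul, add_assoc,
        DirectSum.coe_decompose_mul_add_of_left_mem _ a.2]

theorem IsGradedModule.exists_isGradedDualBasis [IsScalarTower R A M] [GradedAlgebra 𝒜]
    (hM : IsGradedModule 𝒜 ℳ)
    [Module.Finite A M] [Module.Projective A M] :
    ∃ (r : ℕ) (d : Fin r → P) (m : Fin r → M) (φ : Fin r → M →ₗ[A] A),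
      IsGradedDualBasis 𝒜 ℳ d m φ := by
  let _ := hM.is_internal.chooseDecomposition
  let G : Set M := {x | ∃ p, x ∈ ℳ p}
  have hG : Submodule.span A G = ⊤ := eq_top_iff.2 fun x _ => by
    induction x using DirectSum.Decomposition.inductionOn ℳ with
    | zero => exact Submodule.zero_mem _
    | add x y hx hy => exact Submodule.add_mem _ (hx trivial) (hy trivial)
    | @homogeneous p x => exact Submodule.subset_span ⟨p, x.2⟩
  obtain ⟨t, htG, ht⟩ := (Submodule.fg_span_iff_fg_span_finset_subset G).1
    (hG ▸ Module.Finite.fg_top)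
  let m : Fin t.card → M := fun i => t.equivFin.symm i
  have hmG : ∀ i, ∃ p, m i ∈ ℳ p := fun i => htG (t.equivFin.symm i).2
  have hmt : Submodule.span A (Set.range m) = ⊤ := by
    rw [← hG, ht]
    congr 1
    rw [show m = Subtype.val ∘ t.equivFin.symm from rfl, t.equivFin.symm.surjective.range_comp]
    exact Subtype.range_coe
  choose d hd using hmG
  have hsurj : Function.Surjective (Fintype.linearCombination A m) := by
    rw [← LinearMap.range_eq_top, Fintype.range_linearCombination, hmt]
  obtain ⟨g, hg⟩ := Module.projective_lifting_property _ LinearMap.id hsurj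
  choose φ hφ using fun i => exists_linearMap_apply_eq_decompose (ℳ := ℳ) hM.smul_mem
    (LinearMap.proj i ∘ₗ g) (- d i)
  refine ⟨_, d, m, φ, hd, fun i hx => ?_, fun x => ?_⟩
  · rw [hφ i _ _ hx, sub_eq_add_neg]
    exact SetLike.coe_mem _
  · induction x using DirectSum.Decomposition.inductionOn ℳ with
    | zero => simp
    | add x y hx hy => simp only [map_add, add_smul, Finset.sum_add_distrib, hx, hy]
    | @homogeneous p x =>
      have h1 : ∑ i, g x i • m i = (x : M) := by
        rw [← Fintype.linearCombination_apply]
        exact LinearMap.congr_fun hg (x : M)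
      have h2 := congrArg (fun y => (DirectSum.decompose ℳ y p : M)) h1
      beta_reduce at h2
      rw [DirectSum.decompose_of_mem_same _ x.2, DirectSum.decompose_sum, DFinsupp.finsetSum_apply,
        Submodule.coe_sum] at h2
      refine Eq.trans (Finset.sum_congr rfl fun i _ => ?_) h2
      have h3 := coe_decompose_smul_add_of_right_mem (𝒜 := 𝒜) (ℳ := ℳ) hM.smul_mem (p := p + - d i)
        (g x i) (hd i)
      rw [neg_add_cancel_right] at h3
      rw [h3, hφ i p x x.2]
      rfl

end

section

variable {R P : Type*} [CommRing R]

/-- The grading of a submodule `F` of `R^σ` for which the `j`-th coordinate has degree `δ j`. -/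
def coordinateGrading {σ : Type*} (δ : σ → P) (F : Submodule R (σ → R)) (p : P) :
    Submodule R F where
  carrier := {f | ∀ j, δ j ≠ p → f.1 j = 0}
  zero_mem' := fun _ _ => rfl
  add_mem' := fun {f g} hf hg j hj => by
    change f.1 j + g.1 j = 0
    rw [hf j hj, hg j hj, add_zero]
  smul_mem' := fun a f hf j hj => by
    change a * f.1 j = 0
    rw [hf j hj, mul_zero]

theorem coordinateGrading_isInternal [DecidableEq P] {σ : Type*} [Fintype σ] (δ : σ → P)
    (F : Submodule R (σ → R)) (hF : ∀ f ∈ F, ∀ p, (fun j => if δ j = p then f j else 0) ∈ F) :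
    DirectSum.IsInternal (coordinateGrading δ F) := by
  have hcoord : ∀ (x : DirectSum P fun p => coordinateGrading δ F p) j,
      (DirectSum.coeAddMonoidHom (coordinateGrading δ F) x).1 j = (x (δ j)).1.1 j := fun x j => by
    induction x using DirectSum.induction_on with
    | zero => simp
    | add x y hx hy =>
      rw [map_add, DirectSum.add_apply]
      exact congrArg₂ (· + ·) hx hy
    | of p f =>
      rw [DirectSum.coeAddMonoidHom_of]
      by_cases hp : p = δ j
      · subst hp
        rw [DirectSum.of_eq_same]
      · rw [DirectSum.of_eq_of_ne _ _ _ (Ne.symm hp), f.2 j (Ne.symm hp)]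
        rfl
  refine ⟨fun x y hxy => ?_, fun f => ?_⟩
  · refine DFinsupp.ext fun p => Subtype.ext (Subtype.ext (funext fun j => ?_))
    by_cases hp : δ j = p
    · subst hp
      rw [← hcoord, hxy, hcoord]
    · exact ((x p).2 j hp).trans ((y p).2 j hp).symm
  · let c : P → F := fun p => ⟨fun j => if δ j = p then f.1 j else 0, hF _ f.2 p⟩
    have hc : ∀ p, c p ∈ coordinateGrading δ F p := fun p j hj => if_neg hj
    refine ⟨∑ p ∈ Finset.univ.image δ,
      DirectSum.of (fun p => coordinateGrading δ F p) p ⟨c p, hc p⟩,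
      Subtype.ext (funext fun j => ?_)⟩
    rw [hcoord, DFinsupp.finsetSum_apply, Finset.sum_eq_single (δ j), DirectSum.of_eq_same]
    · exact if_pos rfl
    · intro p _ hp
      exact DirectSum.of_eq_of_ne _ _ _ hp.symm
    · intro h
      exact absurd (Finset.mem_image_of_mem δ (Finset.mem_univ j)) h

end

section

variable {R A P M : Type u} [CommRing R] [CommRing A] [Algebra R A] [AddCommGroup P]
  [DecidableEq P] [AddCommGroup M] [Module R M] [Module A M] [IsScalarTower R A M]
  {𝒜 : P → Submodule R A} {ℳ : P → Submodule R M}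

/-- Base change along a matrix splitting turns a graded dual basis into one whose matrix of
pairings has entries in the base ring. -/
theorem IsGradedDualBasis.exists_apply_eq_algebraMap (hM : IsGradedModule 𝒜 ℳ) {ι σ : Type*}
    [Fintype ι] [Fintype σ] {d : ι → P} {m : ι → M} {φ : ι → M →ₗ[A] A}
    [SetLike.GradedMonoid 𝒜] (h : IsGradedDualBasis 𝒜 ℳ d m φ) {δ : σ → P} {V : Matrix ι σ A} {W : Matrix σ ι A}
    {c : Matrix σ σ R} (hs : IsGradedSplitting 𝒜 (fun i => - d i)
      (Matrix.of fun i j => φ i (m j)) δ V W c) :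
    ∃ (n : σ → M) (ψ : σ → M →ₗ[A] A), IsGradedDualBasis 𝒜 ℳ (fun j => - δ j) n ψ ∧
      ∀ i j, ψ i (n j) = algebraMap R A ((c * c) i j) := by
  have hV : ∀ i k, ∑ j, V i j * W j k = φ i (m k) := fun i k =>
    congrFun (congrFun hs.mul_eq i) k
  refine ⟨fun j => ∑ i, V i j • m i, fun j => ∑ i, W j i • φ i, ⟨fun j => ?_, fun {p _} j hx => ?_,
    fun x => ?_⟩, fun i j => ?_⟩
  · refine Submodule.sum_mem _ fun i _ => ?_
    have := hM.smul_mem (hs.graded_left i j) (h.mem i)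
    rwa [show -d i - δ j + d i = -δ j by abel] at this
  · rw [LinearMap.sum_apply]
    refine Submodule.sum_mem _ fun i _ => ?_
    have := SetLike.mul_mem_graded (hs.graded_right j i) (h.apply_mem i hx)
    rwa [show δ j - -d i + (p - d i) = p - -δ j by abel] at this
  · have hφ : ∀ k, ∑ i, φ k (m i) * φ i x = φ k x := fun k => by
      conv_rhs => rw [← h.sum_smul x, map_sum]
      refine Finset.sum_congr rfl fun i _ => ?_
      rw [map_smul, smul_eq_mul, mul_comm]
    conv_rhs => rw [← h.sum_smul x]
    simp only [Finset.smul_sum]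
    rw [Finset.sum_comm]
    refine Finset.sum_congr rfl fun k _ => ?_
    simp only [smul_smul]
    rw [← Finset.sum_smul, ← hφ k]
    simp only [← hV, LinearMap.sum_apply, LinearMap.smul_apply, smul_eq_mul, Finset.sum_mul]
    rw [Finset.sum_comm]
    exact congrArg (· • m k) (Finset.sum_congr rfl fun i _ => Finset.sum_congr rfl fun j _ => by
      ring)
  · have he : W * (Matrix.of fun i j => φ i (m j)) * V = (c * c).map (algebraMap R A) := by
      rw [← hs.mul_eq, Matrix.map_mul, ← hs.mul_eq_map]
      simp only [Matrix.mul_assoc]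
    refine Eq.trans ?_ (congrFun (congrFun he i) j)
    rw [Matrix.mul_assoc, Matrix.mul_apply, LinearMap.sum_apply]
    refine Finset.sum_congr rfl fun k _ => ?_
    rw [LinearMap.smul_apply, smul_eq_mul, map_sum, Matrix.mul_apply]
    refine congrArg _ (Finset.sum_congr rfl fun l _ => ?_)
    rw [map_smul, smul_eq_mul, mul_comm]
    rfl

theorem IsGradedDualBasis.isGradedExtendedFrom [GradedAlgebra 𝒜] (hM : IsGradedModule 𝒜 ℳ)
    (hinj : Function.Injective (algebraMap R A)) {s : ℕ} {d : Fin s → P} {m : Fin s → M}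
    {φ : Fin s → M →ₗ[A] A} (h : IsGradedDualBasis 𝒜 ℳ d m φ) (c : Matrix (Fin s) (Fin s) R)
    (hc : ∀ i j, φ i (m j) = algebraMap R A (c i j)) : IsGradedExtendedFrom R 𝒜 M ℳ := by
  have hcm : ∀ k, ∑ j, c j k • m j = m k := fun k => by
    conv_rhs => rw [← h.sum_smul (m k)]
    refine Finset.sum_congr rfl fun j _ => ?_
    rw [hc, algebraMap_smul]
  have hcc : c * c = c := by
    refine Matrix.map_injective hinj ?_
    ext1 i j
    change algebraMap R A ((c * c) i j) = algebraMap R A (c i j)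
    rw [← hc, ← h.sum_smul (m j), map_sum, Matrix.mul_apply, map_sum]
    refine Finset.sum_congr rfl fun k _ => ?_
    rw [map_smul, hc, hc, map_mul, smul_eq_mul, mul_comm]
  have hcd : ∀ i j, d i ≠ d j → c i j = 0 := fun i j hij => by
    by_contra hne
    have h1 := h.apply_mem i (h.mem j)
    rw [hc] at h1
    have := DirectSum.degree_eq_of_mem_mem 𝒜 h1 (SetLike.algebraMap_mem_graded 𝒜 _)
      fun h0 => hne (hinj (h0.trans (map_zero _).symm))
    exact hij (sub_eq_zero.1 this).symm
  let ρ := (Matrix.toLin' c).rangeRestrict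
  let F := LinearMap.range (Matrix.toLin' c)
  have hF : ∀ f ∈ F, c *ᵥ f = f := by
    rintro _ ⟨g, rfl⟩
    rw [Matrix.toLin'_apply, Matrix.mulVec_mulVec, hcc]
  have hFp : ∀ f ∈ F, ∀ p, (fun j => if d j = p then f j else 0) ∈ F := fun f hf p => by
    refine ⟨fun j => if d j = p then f j else 0, ?_⟩
    ext i
    rw [Matrix.toLin'_apply, Matrix.mulVec, dotProduct]
    split_ifs with hi
    · conv_rhs => rw [← hF f hf, Matrix.mulVec, dotProduct]
      refine Finset.sum_congr rfl fun j _ => ?_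
      split_ifs with hj
      · rfl
      · rw [hcd i j fun hij => hj (hij ▸ hi), zero_mul, zero_mul]
    · refine Finset.sum_eq_zero fun j _ => ?_
      split_ifs with hj
      · rw [hcd i j fun hij => hi (hij.trans hj), zero_mul]
      · rw [mul_zero]
  have hρ : ρ ∘ₗ F.subtype = LinearMap.id := LinearMap.ext fun f => Subtype.ext (hF f f.2)
  have hρd : ∀ j, ρ (Pi.single j 1) ∈ coordinateGrading d F (d j) := fun j i hij => by
    change (Matrix.toLin' c) (Pi.single j 1) i = 0
    rw [Matrix.toLin'_apply, Matrix.mulVec_single_one]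
    exact hcd i j hij
  let μ : F →ₗ[R] M := Fintype.linearCombination R m ∘ₗ F.subtype
  have hμρ : ∀ j, μ (ρ (Pi.single j 1)) = m j := fun j => by
    change Fintype.linearCombination R m ((Matrix.toLin' c) (Pi.single j 1)) = m j
    rw [Matrix.toLin'_apply, Matrix.mulVec_single_one, Fintype.linearCombination_apply]
    exact hcm j
  let Φ : A ⊗[R] F →ₗ[A] M := μ.liftBaseChange A
  let Ψ : M →ₗ[A] A ⊗[R] F :=
    ∑ j, (LinearMap.toSpanSingleton A (A ⊗[R] F) (1 ⊗ₜ[R] ρ (Pi.single j 1))) ∘ₗ φ j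
  have hΨ : ∀ x, Ψ x = ∑ j, φ j x ⊗ₜ[R] ρ (Pi.single j 1) := fun x => by
    simp [Ψ, LinearMap.sum_apply, TensorProduct.smul_tmul']
  have hΦ : ∀ a f, Φ (a ⊗ₜ f) = a • μ f := fun a f => LinearMap.liftBaseChange_tmul ..
  have hΦΨ : Φ ∘ₗ Ψ = LinearMap.id := LinearMap.ext fun x => by
    rw [LinearMap.comp_apply, hΨ, map_sum]
    simp only [hΦ, hμρ]
    exact h.sum_smul x
  have hΨμ : ∀ f, Ψ (μ f) = 1 ⊗ₜ f := fun f => by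
    have hφμ : ∀ j, φ j (μ f) = algebraMap R A (f.1 j) := fun j => by
      conv_rhs => rw [← hF f.1 f.2, Matrix.mulVec, dotProduct, map_sum]
      change φ j (Fintype.linearCombination R m f.1) = _
      rw [Fintype.linearCombination_apply, map_sum]
      refine Finset.sum_congr rfl fun k _ => ?_
      rw [← algebraMap_smul A, map_smul, hc, smul_eq_mul, map_mul, mul_comm]
    have hf : f = ∑ j, f.1 j • ρ (Pi.single j 1) := by
      refine (LinearMap.congr_fun hρ f).symm.trans ?_
      change ρ f.1 = _
      conv_lhs => rw [pi_eq_sum_univ' f.1, map_sum]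
      simp only [map_smul]
    conv_rhs => rw [hf, TensorProduct.tmul_sum]
    rw [hΨ]
    refine Finset.sum_congr rfl fun j _ => ?_
    rw [hφμ, Algebra.algebraMap_eq_smul_one, TensorProduct.smul_tmul]
  have hΨΦ : Ψ ∘ₗ Φ = LinearMap.id := by
    refine TensorProduct.AlgebraTensorModule.ext fun a f => ?_
    rw [LinearMap.comp_apply, hΦ, map_smul, hΨμ, TensorProduct.smul_tmul', smul_eq_mul, mul_one]
    rfl
  refine ⟨F, inferInstance, inferInstance, coordinateGrading d F,
    coordinateGrading_isInternal d F hFp, inferInstance, Module.Projective.of_split _ _ hρ,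
    LinearEquiv.ofLinearMap Ψ Φ hΨΦ hΦΨ, fun p x hx => ?_, fun p z hz => ?_⟩
  · change Ψ x ∈ _
    rw [hΨ]
    refine Submodule.sum_mem _ fun j _ => Submodule.subset_span
      ⟨p - d j, d j, sub_add_cancel _ _, _, h.apply_mem j hx, _, hρd j, rfl⟩
  · change Φ z ∈ _
    induction hz using Submodule.span_induction with
    | zero => rw [map_zero]; exact Submodule.zero_mem _
    | add x y _ _ hx hy => rw [map_add]; exact Submodule.add_mem _ hx hy
    | smul r x _ hx =>
      rw [← algebraMap_smul A r x, map_smul, algebraMap_smul]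
      exact Submodule.smul_mem _ _ hx
    | mem z hz =>
      obtain ⟨a, b, rfl, x, hx, f, hf, rfl⟩ := hz
      rw [hΦ]
      refine hM.smul_mem hx ?_
      change Fintype.linearCombination R m f.1 ∈ _
      rw [Fintype.linearCombination_apply]
      refine Submodule.sum_mem _ fun j _ => ?_
      by_cases hj : d j = b
      · exact hj ▸ Submodule.smul_mem _ _ (h.mem j)
      · rw [hf j hj, zero_smul]
        exact Submodule.zero_mem _

end

theorem monAlgGrading_eq_gradeBy (R : Type*) [CommRing R] {Λ P : Type*} [AddCommMonoid Λ]
    (deg : Λ → P) : monAlgGrading R deg = AddMonoidAlgebra.gradeBy R deg := by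
  funext p
  refine le_antisymm (Submodule.span_le.2 ?_) fun f hf => ?_
  · rintro _ ⟨s, rfl, rfl⟩
    exact AddMonoidAlgebra.single_mem_gradeBy _ _ _
  · rw [← AddMonoidAlgebra.sum_coeff_single f]
    refine Submodule.sum_mem _ fun s hs => ?_
    rw [← mul_one (f.coeff s), ← smul_eq_mul, ← AddMonoidAlgebra.smul_single]
    exact Submodule.smul_mem _ _ (Submodule.subset_span
      ⟨s, AddMonoidAlgebra.mem_gradeBy_iff_coeff.1 hf s (Finsupp.mem_support_iff.1 hs), rfl⟩)

theorem IsGradedModule.isGradedExtendedFrom {R P M : Type u} {Λ : Type} [CommRing R] [AddCommMonoid Λ]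
    [AddCommGroup P] [DecidableEq P] {deg : Λ →+ P} [AddCommGroup M] [Module R M]
    [Module (AddMonoidAlgebra R Λ) M] [IsScalarTower R (AddMonoidAlgebra R Λ) M]
    [Module.Finite (AddMonoidAlgebra R Λ) M] [Module.Projective (AddMonoidAlgebra R Λ) M]
    (h : GradedIdempotentsSplit (R := R) (fun _ => Set.univ) deg) {ℳ : P → Submodule R M}
    (hM : IsGradedModule (AddMonoidAlgebra.gradeBy R deg) ℳ) :
    IsGradedExtendedFrom R (AddMonoidAlgebra.gradeBy R deg) M ℳ := by
  let _ := AddMonoidAlgebra.gradeBy.gradedAlgebra (R := R) deg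
  obtain ⟨r, d, m, φ, hφ⟩ := hM.exists_isGradedDualBasis
  obtain ⟨s, δ, V, W, c, -, hs⟩ := h r (fun i => - d i) (Matrix.of fun i j => φ i (m j)) (by
    ext1 i j
    rw [Matrix.mul_apply, Matrix.of_apply]
    conv_rhs => rw [← hφ.sum_smul (m j), map_sum]
    refine Finset.sum_congr rfl fun k _ => ?_
    rw [map_smul, smul_eq_mul, mul_comm]
    rfl) fun i j => by
      rw [neg_sub_neg]
      exact hφ.apply_mem i (hφ.mem j)
  obtain ⟨n, ψ, hψ, hc⟩ := hφ.exists_apply_eq_algebraMap hM hs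
  refine hψ.isGradedExtendedFrom hM (fun a b hab => ?_) _ hc
  exact Finsupp.single_injective 0 (congrArg AddMonoidAlgebra.coeff hab)

end

/-!
STATEMENT 4 (Theorem `Main-3`):
Let `R` be a noetherian integral domain whose localization at every maximal ideal
satisfies condition (††), and let `P` be a finitely generated abelian group.  Let
`A = R[x_1,…,x_n]` (realized as `R[ℕ^n]`) be `P`-graded with `x_i` homogeneous of
degree `λ i` and `R` of degree `0`.  Then every finitely generated `P`-graded
`A`-module which is projective as an `A`-module is extended from `R`, i.e. isomorphic
as a `P`-graded `A`-module to `F ⊗_R A` for some `P`-graded `R`-module `F` which is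
finitely generated and projective over `R`.
-/
theorem equivariant_bass_quillen_local_condDaggerDagger
    (R : Type u) [CommRing R] [IsDomain R] [IsNoetherianRing R]
    (hloc : ∀ (m : Ideal R) (hm : m.IsMaximal),
      CondDaggerDagger (@Localization.AtPrime R _ m hm.isPrime))
    (P : Type u) [AddCommGroup P] [AddGroup.FG P] [DecidableEq P]
    (n : ℕ) (lam : Fin n → P)
    (M : Type u) [AddCommGroup M] [Module R M]
    [Module (AddMonoidAlgebra R (Fin n → ℕ)) M]
    [IsScalarTower R (AddMonoidAlgebra R (Fin n → ℕ)) M]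
    (ℳ : P → Submodule R M)
    (hM : IsGradedModule
      (monAlgGrading R (fun m : Fin n → ℕ => ∑ i, (m i) • lam i)) ℳ)
    (hfin : Module.Finite (AddMonoidAlgebra R (Fin n → ℕ)) M)
    (hproj : Module.Projective (AddMonoidAlgebra R (Fin n → ℕ)) M) :
    IsGradedExtendedFrom R
      (monAlgGrading R (fun m : Fin n → ℕ => ∑ i, (m i) • lam i)) M ℳ := by
  let deg : (Fin n → ℕ) →+ P :=
    { toFun := fun m => ∑ i, m i • lam i
      map_zero' := by simp
      map_add' := fun a b => by simp [add_smul, Finset.sum_add_distrib] }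
  have hgr : monAlgGrading R (fun m : Fin n → ℕ => ∑ i, (m i) • lam i) =
    AddMonoidAlgebra.gradeBy R deg := monAlgGrading_eq_gradeBy R _
  rw [hgr] at hM ⊢
  exact hM.isGradedExtendedFrom (.pi_nat (fun m hm b deg => (hloc m hm).gradedIdempotentsSplit b deg)
    n deg)
end

section
/- Let R be a commutative noetherian ring, P a finitely generated abelian group, L a lattice, σ ⊆ L_ℚ a strongly convex rational polyhedral cone, and ψ: L → P a homomorphism making A = R[σ∩L] a P-graded R-algebra. Let Q = ψ(L) ⊆ P, so that A is also Q-graded via the corestriction of ψ. If every finitely generated Q-graded A-module that is projective over A is trivial (isomorphic as a Q-graded A-module to F' ⊗_R A for some Q-graded R-module F' finitely generated projective over R), then every finitely generated P-graded A-module that is projective over A is trivial (isomorphic as a P-graded A-module to F ⊗_R A for some P-graded R-module F finitely generated projective over R). -/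
open scoped TensorProduct

universe u

namespace DirectSum

variable {R M ι : Type*} [Ring R] [AddCommGroup M] [Module R M]

theorem isInternal_of_forall_le_ker [DecidableEq ι] {A : ι → Submodule R M} (hA : iSup A = ⊤)
    {κ : Type*} {N : κ → Type*} [∀ k, AddCommGroup (N k)] [∀ k, Module R (N k)]
    (π : ∀ k, M →ₗ[R] N k) (g : κ → ι) (hπ : ∀ k i, i ≠ g k → A i ≤ LinearMap.ker (π k))
    (hinj : ∀ x, (∀ k, π k x = 0) → x = 0) : IsInternal A := by
  refine isInternal_submodule_of_iSupIndep_of_iSup_eq_top (fun i => ?_) hA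
  refine Submodule.disjoint_def.2 fun x hx hx' => hinj x fun k => ?_
  by_cases hi : i = g k
  · exact (iSup₂_le fun j hj => hπ k j (hi ▸ hj) : _ ≤ LinearMap.ker (π k)) hx'
  · exact hπ k i hi hx

theorem IsInternal.exists_forall_le_ker [DecidableEq ι] {A : ι → Submodule R M}
    (hA : IsInternal A) :
    ∃ π : ι → M →ₗ[R] M, (∀ i j, j ≠ i → A j ≤ LinearMap.ker (π i)) ∧
      ∀ x, (∀ i, π i x = 0) → x = 0 := by
  let _ := hA.chooseDecomposition
  refine ⟨fun i => (A i).subtype ∘ₗ component R ι (fun i => A i) i ∘ₗ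
    (decomposeLinearEquiv A).toLinearMap, fun i j hij x hx => ?_, fun x hx => ?_⟩
  · exact decompose_of_mem_ne A hx hij
  · apply (decompose A).injective
    rw [decompose_zero]
    ext i
    exact hx i

end DirectSum

namespace IsGradedModule

variable {R A P M : Type*} [CommRing R] [Ring A] [Algebra R A] [AddCommGroup P] [DecidableEq P]
  [AddCommGroup M] [Module R M] [Module A M] [IsScalarTower R A M]
  {𝒜 : P → Submodule R A} {ℳ : P → Submodule R M} {H : AddSubgroup P}

/-- The `A`-submodule of `M` spanned by the degrees in the coset `p + H`, when `A` is concentrated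
in degrees in `H`. -/
def cosetPart (hM : IsGradedModule 𝒜 ℳ) (h𝒜 : ⨆ h : H, 𝒜 h = ⊤) (p : P) : Submodule A M where
  carrier := (⨆ h : H, ℳ (p + h) : Submodule R M)
  zero_mem' := zero_mem _
  add_mem' := add_mem
  smul_mem' a x hx := by
    have ha : a ∈ ⨆ h : H, 𝒜 h := h𝒜 ▸ Submodule.mem_top
    induction ha using Submodule.iSup_induction' with
    | zero => simp
    | add a b _ _ ha hb => rw [add_smul]; exact add_mem ha hb
    | mem h a ha =>
      induction hx using Submodule.iSup_induction' with
      | zero => simp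
      | add x y _ _ hx hy => rw [smul_add]; exact add_mem hx hy
      | mem k x hx =>
        refine Submodule.mem_iSup_of_mem (h + k) ?_
        have := hM.smul_mem ha hx
        rwa [add_left_comm] at this

variable (hM : IsGradedModule 𝒜 ℳ) (h𝒜 : ⨆ h : H, 𝒜 h = ⊤)

theorem mem_cosetPart {p : P} {x : M} :
    x ∈ hM.cosetPart h𝒜 p ↔ x ∈ ⨆ h : H, ℳ (p + h) := Iff.rfl

theorem le_cosetPart {p c : P} (hc : (p : P ⧸ H) = c) {x : M} (hx : x ∈ ℳ c) :
    x ∈ hM.cosetPart h𝒜 p := by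
  refine Submodule.mem_iSup_of_mem ⟨-p + c, QuotientAddGroup.eq.1 hc⟩ ?_
  simpa using hx

theorem isInternal_cosetPart [DecidableEq (P ⧸ H)] (s : P ⧸ H → P) (hs : ∀ c, (s c : P ⧸ H) = c) :
    DirectSum.IsInternal fun c : P ⧸ H => hM.cosetPart h𝒜 (s c) := by
  obtain ⟨π, hπ, hinj⟩ := hM.is_internal.exists_forall_le_ker
  have : DirectSum.IsInternal fun c : P ⧸ H => ⨆ h : H, ℳ (s c + h) := by
    refine DirectSum.isInternal_of_forall_le_ker ?_ π (fun p => (p : P ⧸ H))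
      (fun p c hc => iSup_le fun h => hπ _ _ ?_) hinj
    · rw [eq_top_iff, ← hM.is_internal.submodule_iSup_eq_top]
      exact iSup_le fun p x hx =>
        Submodule.mem_iSup_of_mem (p : P ⧸ H) (hM.le_cosetPart h𝒜 (hs p) hx)
    · rintro rfl
      simp [hs] at hc
  exact this

/-- The grading of `cosetPart` by the subgroup `H`. -/
def cosetGrading (p : P) (h : H) : Submodule R (hM.cosetPart h𝒜 p) :=
  (ℳ (p + h)).comap ((hM.cosetPart h𝒜 p).subtype.restrictScalars R)

theorem isGradedModule_cosetGrading (p : P) :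
    IsGradedModule (fun h : H => 𝒜 h) (hM.cosetGrading h𝒜 p) where
  is_internal := by
    obtain ⟨π, hπ, hinj⟩ := hM.is_internal.exists_forall_le_ker
    refine DirectSum.isInternal_of_forall_le_ker ?_
      (fun h : H => π (p + h) ∘ₗ (hM.cosetPart h𝒜 p).subtype.restrictScalars R) id
      (fun h k hk x hx => ?_) (fun x hx => ?_)
    · rw [eq_top_iff]
      rintro ⟨x, hx⟩ -
      rw [mem_cosetPart] at hx
      induction hx using Submodule.iSup_induction' with
      | zero => exact zero_mem _
      | add x y hx' hy' ihx ihy => exact add_mem (ihx hx') (ihy hy')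
      | mem h x hx' => exact Submodule.mem_iSup_of_mem h hx'
    · exact hπ _ _ (by simpa using hk) hx
    · refine Subtype.ext (hinj _ fun c => ?_)
      by_cases hc : -p + c ∈ H
      · simpa using hx ⟨-p + c, hc⟩
      · have : ⨆ h : H, ℳ (p + h) ≤ LinearMap.ker (π c) := by
          refine iSup_le fun h => hπ _ _ ?_
          rintro rfl
          simp at hc
        exact this x.2
  smul_mem {a b x m} hx hm := by
    have : x • (m : M) ∈ ℳ (a + (p + b)) := hM.smul_mem hx hm
    rwa [add_left_comm] at this

end IsGradedModule

section cosetSum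

variable {R P : Type*} [CommRing R] [AddCommGroup P] {H : AddSubgroup P}
  {F : P ⧸ H → Type*} [∀ c, AddCommGroup (F c)] [∀ c, Module R (F c)]

open scoped DirectSum

/-- The `P`-grading of `⨁ c, F c` for which the piece of degree `h` of the `H`-graded module `F c`
has degree `s c + h`. -/
noncomputable def cosetSumGrading [DecidableEq (P ⧸ H)] (s : P ⧸ H → P)
    (hs : ∀ c, (s c : P ⧸ H) = c) (ℱ : ∀ c, H → Submodule R (F c)) (p : P) :
    Submodule R (⨁ c, F c) :=
  (ℱ p ⟨-s p + p, QuotientAddGroup.eq.1 (hs p)⟩).map (DirectSum.lof R (P ⧸ H) F p)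

variable [DecidableEq (P ⧸ H)] {s : P ⧸ H → P} {hs : ∀ c, (s c : P ⧸ H) = c}
  {ℱ : ∀ c, H → Submodule R (F c)}

theorem lof_mem_cosetSumGrading {c : P ⧸ H} {h : H} {f : F c} (hf : f ∈ ℱ c h) {p : P}
    (hp : s c + h = p) :
    DirectSum.lof R (P ⧸ H) F c f ∈ cosetSumGrading s hs ℱ p := by
  obtain rfl : (p : P ⧸ H) = c := by rw [← hp]; simp [hs]
  refine ⟨f, ?_, rfl⟩
  obtain rfl : h = ⟨-s p + p, QuotientAddGroup.eq.1 (hs p)⟩ := Subtype.ext (eq_neg_add_of_add_eq hp)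
  exact hf

theorem isInternal_cosetSumGrading [DecidableEq P] (hℱ : ∀ c, DirectSum.IsInternal (ℱ c)) :
    DirectSum.IsInternal (cosetSumGrading s hs ℱ) := by
  choose π hπ hinj using fun c => (hℱ c).exists_forall_le_ker
  refine DirectSum.isInternal_of_forall_le_ker ?_
    (fun p : P => π p ⟨-s p + p, QuotientAddGroup.eq.1 (hs p)⟩ ∘ₗ
      DirectSum.component R (P ⧸ H) F p) id ?_ ?_
  · rw [eq_top_iff]
    rintro x -
    induction x using DirectSum.induction_on with
    | zero => exact zero_mem _
    | add x y hx hy => exact add_mem hx hy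
    | of c f =>
      have hf : f ∈ iSup (ℱ c) := (hℱ c).submodule_iSup_eq_top ▸ Submodule.mem_top
      induction hf using Submodule.iSup_induction' with
      | zero => simp
      | add x y _ _ hx hy => rw [map_add]; exact add_mem hx hy
      | mem h f hf => exact Submodule.mem_iSup_of_mem (s c + h) (lof_mem_cosetSumGrading hf rfl)
  · rintro p p' hp _ ⟨f, hf, rfl⟩
    rw [LinearMap.mem_ker, LinearMap.comp_apply]
    by_cases hc : (p' : P ⧸ H) = p
    · have key : ∀ c (hc : (p' : P ⧸ H) = c) (h : -s c + p ∈ H), π c ⟨-s c + p, h⟩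
          (DirectSum.component R (P ⧸ H) F c (DirectSum.lof R (P ⧸ H) F p' f)) = 0 := by
        rintro _ rfl h
        rw [DirectSum.component.lof_self]
        exact hπ _ _ _ (by simpa using hp) hf
      exact key _ hc _
    · rw [DirectSum.component.of, dif_neg hc, map_zero]
  · intro x hx
    refine DirectSum.ext_component R fun c => ?_
    refine hinj c _ fun h => ?_
    have := hx (s c + h)
    have hc : ((s c + h : P) : P ⧸ H) = c := by simp [hs]
    have key : ∀ c' (hc : c' = c) (h' : -s c' + (s c + h) ∈ H), π c' ⟨-s c' + (s c + h), h'⟩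
        (DirectSum.component R (P ⧸ H) F c' x) = 0 →
        π c h (DirectSum.component R (P ⧸ H) F c x) = 0 := by
      rintro _ rfl h' e
      simpa using e
    exact key _ hc _ this

end cosetSum

open scoped DirectSum in
theorem isGradedExtendedFrom_of_subgroup {R A P : Type u} [CommRing R] [CommRing A] [Algebra R A]
    [Module.Free R A] [FaithfulSMul R A] [AddCommGroup P] [DecidableEq P] (H : AddSubgroup P)
    (𝒜 : P → Submodule R A) (h𝒜 : ⨆ h : H, 𝒜 h = ⊤) (h𝒜' : ∀ p ∉ H, 𝒜 p = ⊥)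
    (hH : ∀ (M : Type u) [AddCommGroup M] [Module R M] [Module A M] [IsScalarTower R A M]
      (ℳ : H → Submodule R M), IsGradedModule (fun h : H => 𝒜 h) ℳ → Module.Finite A M →
      Module.Projective A M → IsGradedExtendedFrom R (fun h : H => 𝒜 h) M ℳ)
    (M : Type u) [AddCommGroup M] [Module R M] [Module A M] [IsScalarTower R A M]
    (ℳ : P → Submodule R M) (hM : IsGradedModule 𝒜 ℳ) [Module.Finite A M]
    [Module.Projective A M] : IsGradedExtendedFrom R 𝒜 M ℳ := by
  classical
  let s : P ⧸ H → P := Quotient.out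
  have hs (c : P ⧸ H) : (s c : P ⧸ H) = c := Quotient.out_eq c
  let N (c : P ⧸ H) : Submodule A M := hM.cosetPart h𝒜 (s c)
  let eN : (⨁ c, N c) ≃ₗ[A] M :=
    LinearEquiv.ofBijective (DirectSum.coeLinearMap N) (hM.isInternal_cosetPart h𝒜 s hs)
  have hproj : ∀ c, Module.Projective A (N c) :=
    Module.Projective.directSum_iff.1 (Module.Projective.of_equiv eN.symm)
  have hfin (c : P ⧸ H) : Module.Finite A (N c) :=
    Module.Finite.of_surjective (DirectSum.component A _ (fun c => N c) c ∘ₗ eN.symm.toLinearMap)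
      fun x => ⟨eN (DirectSum.lof A _ (fun c => N c) c x), by simp⟩
  choose F _ _ ℱ hℱ _ _ e he he' using fun c => hH (N c) _
    (hM.isGradedModule_cosetGrading h𝒜 (s c)) (hfin c) (hproj c)
  let E : M ≃ₗ[A] A ⊗[R] (⨁ c, F c) :=
    eN.symm ≪≫ₗ DFinsupp.mapRange.linearEquiv e ≪≫ₗ (TensorProduct.directSumRight R A A F).symm
  have hE (c : P ⧸ H) (x : N c) :
      E x = (TensorProduct.directSumRight R A A F).symm (DirectSum.lof A _ _ c (e c x)) := by
    have : eN.symm x = DirectSum.lof A _ (fun c => N c) c x := by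
      rw [LinearEquiv.symm_apply_eq]
      exact (DirectSum.coeLinearMap_lof N c x).symm
    simp only [E, LinearEquiv.trans_apply, this]
    congr 1
    exact DFinsupp.mapRange_single (hf := fun i => map_zero (e i))
  have hE' (c : P ⧸ H) (a : A) (f : F c) :
      E.symm (a ⊗ₜ DirectSum.lof R _ F c f) = ((e c).symm (a ⊗ₜ f) : N c) := by
    rw [LinearEquiv.symm_apply_eq, hE, LinearEquiv.apply_symm_apply,
      TensorProduct.directSumRight_symm_lof_tmul]
  have hfinF : Module.Finite R (⨁ c, F c) := by
    cases subsingleton_or_nontrivial R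
    · have := Module.subsingleton R (⨁ c, F c)
      infer_instance
    · have : Nontrivial A := (FaithfulSMul.algebraMap_injective R A).nontrivial
      have := Module.Finite.equiv E
      exact Module.Finite.of_finite_tensorProduct_of_faithfullyFlat A
  refine ⟨⨁ c, F c, _, _, cosetSumGrading s hs ℱ, isInternal_cosetSumGrading hℱ, hfinF,
    inferInstance, E, fun p m hm => ?_, fun p => ?_⟩
  · lift m to N p using hM.le_cosetPart h𝒜 (hs p) hm
    rw [hE]
    have hm' := he (p : P ⧸ H) ⟨-s p + p, QuotientAddGroup.eq.1 (hs p)⟩ m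
      (by simpa [IsGradedModule.cosetGrading] using hm)
    let φ : A ⊗[R] F p →ₗ[R] A ⊗[R] ⨁ c, F c :=
      ((TensorProduct.directSumRight R A A F).symm.toLinearMap ∘ₗ
        DirectSum.lof A _ (fun c => A ⊗[R] F c) p).restrictScalars R
    have hφ : tensorGrading (fun h : H => 𝒜 h) (ℱ p) ⟨-s p + p, QuotientAddGroup.eq.1 (hs p)⟩ ≤
        (tensorGrading 𝒜 (cosetSumGrading s hs ℱ) p).comap φ := by
      refine Submodule.span_le.2 ?_
      rintro _ ⟨a, b, hab, x, hx, f, hf, rfl⟩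
      refine Submodule.subset_span ⟨a, s p + b, ?_, x, hx, _, lof_mem_cosetSumGrading hf rfl,
        TensorProduct.directSumRight_symm_lof_tmul ..⟩
      have := congrArg Subtype.val hab
      simp only [AddSubgroup.coe_add] at this
      rw [add_left_comm, this, add_neg_cancel_left]
    exact hφ hm'
  · suffices h : tensorGrading 𝒜 (cosetSumGrading s hs ℱ) p ≤
        (ℳ p).comap (E.symm.toLinearMap.restrictScalars R) from fun x hx => h hx
    refine Submodule.span_le.2 ?_
    rintro _ ⟨a, b, rfl, x, hx, _, ⟨f, hf, rfl⟩, rfl⟩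
    change E.symm _ ∈ ℳ (a + b)
    by_cases ha : a ∈ H
    · have := he' (b : P ⧸ H) (⟨a, ha⟩ + ⟨-s b + b, QuotientAddGroup.eq.1 (hs b)⟩) (x ⊗ₜ f)
        (Submodule.subset_span ⟨_, _, rfl, x, hx, f, hf, rfl⟩)
      rw [hE']
      simpa [IsGradedModule.cosetGrading, add_left_comm (s b)] using this
    · rw [h𝒜' a ha, Submodule.mem_bot] at hx
      simp [hx]

theorem monAlgGrading_rangeRestrict (R : Type*) [CommRing R] {Λ L P : Type*} [AddCommMonoid Λ]
    [AddCommGroup L] [AddCommGroup P] (ψ : L →+ P) (i : Λ → L) (h : ψ.range) :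
    monAlgGrading R (fun s => ψ.rangeRestrict (i s)) h = monAlgGrading R (fun s => ψ (i s)) h := by
  simp [monAlgGrading, Subtype.ext_iff]

theorem monAlgGrading_eq_bot {R : Type*} [CommRing R] {Λ P : Type*} [AddCommMonoid Λ]
    {deg : Λ → P} {p : P} (hp : ∀ s, deg s ≠ p) : monAlgGrading R deg p = ⊥ := by
  simp [monAlgGrading, hp]

theorem iSup_monAlgGrading (R : Type*) [CommRing R] {Λ P : Type*} [AddCommMonoid Λ]
    (deg : Λ → P) : ⨆ p, monAlgGrading R deg p = ⊤ := by
  rw [eq_top_iff, ← (AddMonoidAlgebra.basis Λ R).span_eq, Submodule.span_le]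
  rintro _ ⟨s, rfl⟩
  exact Submodule.mem_iSup_of_mem (deg s) (Submodule.subset_span ⟨s, rfl, by simp⟩)

/-!
STATEMENT 15 (Lemma `Reductn-to-torus-subgp.`):
With `R`, `P`, `L`, `σ`, `ψ : L → P` and `A = R[σ ∩ L]` as usual, let `Q = ψ(L) ⊆ P`,
so that `A` is also `Q`-graded via the corestriction of `ψ`.  If every finitely
generated `Q`-graded `A`-module which is projective over `A` is trivial, then every
finitely generated `P`-graded `A`-module which is projective over `A` is trivial.
-/
theorem reduction_to_faithful_grading_group
    (R : Type u) [CommRing R] [IsNoetherianRing R]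
    (P : Type u) [AddCommGroup P] [AddGroup.FG P] [DecidableEq P]
    (L : Type u) [AddCommGroup L] [Module.Free ℤ L] [Module.Finite ℤ L]
    (q : ℕ) (l : Fin q → L →+ ℚ) (hlne : ∀ i, l i ≠ 0)
    (hspan : SpansLattice (coneLatticePoints l))
    (ψ : L →+ P)
    (hQ : ∀ (M : Type u) [AddCommGroup M] [Module R M]
        [Module (AddMonoidAlgebra R ↥(coneLatticePoints l)) M]
        [IsScalarTower R (AddMonoidAlgebra R ↥(coneLatticePoints l)) M]
        (ℳ : ↥ψ.range → Submodule R M),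
      IsGradedModule
        (monAlgGrading R (fun s : ↥(coneLatticePoints l) => ψ.rangeRestrict (s : L))) ℳ →
      Module.Finite (AddMonoidAlgebra R ↥(coneLatticePoints l)) M →
      Module.Projective (AddMonoidAlgebra R ↥(coneLatticePoints l)) M →
      IsGradedExtendedFrom R
        (monAlgGrading R (fun s : ↥(coneLatticePoints l) => ψ.rangeRestrict (s : L))) M ℳ)
    (M : Type u) [AddCommGroup M] [Module R M]
    [Module (AddMonoidAlgebra R ↥(coneLatticePoints l)) M]
    [IsScalarTower R (AddMonoidAlgebra R ↥(coneLatticePoints l)) M]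
    (ℳ : P → Submodule R M)
    (hM : IsGradedModule (monAlgGrading R (fun s : ↥(coneLatticePoints l) => ψ (s : L))) ℳ)
    (hfin : Module.Finite (AddMonoidAlgebra R ↥(coneLatticePoints l)) M)
    (hproj : Module.Projective (AddMonoidAlgebra R ↥(coneLatticePoints l)) M) :
    IsGradedExtendedFrom R
      (monAlgGrading R (fun s : ↥(coneLatticePoints l) => ψ (s : L))) M ℳ := by
  have hgr := funext (monAlgGrading_rangeRestrict R ψ
    (fun s : ↥(coneLatticePoints l) => (s : L)))
  rw [hgr] at hQ
  have : Module.Free R (AddMonoidAlgebra R ↥(coneLatticePoints l)) :=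
    .of_basis (AddMonoidAlgebra.basis _ R)
  refine isGradedExtendedFrom_of_subgroup ψ.range _ ?_ (fun p hp => ?_) hQ M ℳ hM
  · rw [← hgr]
    exact iSup_monAlgGrading R _
  · exact monAlgGrading_eq_bot fun s hs => hp ⟨s, hs⟩
end
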